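/- Let ℓ ∈ ℕ, ℓ ≥ 1, be fixed. There exists a constant C > 0, independent of m and f, such that for all m ∈ ℕ, m ≥ 1, and all f ∈ C([0,1]), ‖f − B_{m,ℓ}(f)‖ ≤ C · ( ω_φ^{2ℓ}(f, 1/√m) + ‖f‖ / m^ℓ ). -/

import Mathlib

open Set MeasureTheory

/-- Bernstein basis polynomial `p_{m,k}(x) = C(m,k) x^k (1-x)^(m-k)`. -/
noncomputable def bern (m k : ℕ) (x : ℝ) : ℝ :=
  (m.choose k : ℝ) * x ^ k * (1 - x) ^ (m - k)

/-- The Bernstein operator `B_m`. -/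
noncomputable def Bop (m : ℕ) (f : ℝ → ℝ) : ℝ → ℝ :=
  fun x => ∑ k ∈ Finset.range (m + 1), bern m k x * f ((k : ℝ) / (m : ℝ))

/-- The generalized Bernstein operator `B_{m,ℓ} = I - (I - B_m)^ℓ`. -/
noncomputable def GBop (m l : ℕ) (f : ℝ → ℝ) : ℝ → ℝ :=
  fun x => f x - ((fun g => g - Bop m g)^[l] f) x

/-- Fundamental generalized Bernstein polynomials
`p^{(ℓ)}_{m,j} = ∑_{i=1}^ℓ C(ℓ,i) (-1)^{i-1} B_m^{i-1}(p_{m,j})`. -/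
noncomputable def gbBasis (m l j : ℕ) : ℝ → ℝ :=
  fun x => ∑ i ∈ Finset.Icc 1 l,
    (l.choose i : ℝ) * (-1 : ℝ) ^ (i - 1) * ((Bop m)^[i - 1] (bern m j) x)

/-- Sup norm on `[0,1]`. -/
noncomputable def supNorm (f : ℝ → ℝ) : ℝ := ⨆ x : Set.Icc (0 : ℝ) 1, |f (x : ℝ)|

/-- `φ(x) = √(x(1-x))`. -/
noncomputable def phiDT (x : ℝ) : ℝ := Real.sqrt (x * (1 - x))

/-- Symmetric difference `Δ^r_{hφ} f(x)`. -/
noncomputable def dtDiff (r : ℕ) (h : ℝ) (f : ℝ → ℝ) (x : ℝ) : ℝ :=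
  ∑ k ∈ Finset.range (r + 1),
    (-1 : ℝ) ^ k * (r.choose k : ℝ) * f (x + ((r : ℝ) - 2 * k) * (h / 2) * phiDT x)

/-- `x ∈ [0,1]` and all the nodes of `Δ^r_{hφ} f(x)` lie in `[0,1]`. -/
def dtAdmissible (r : ℕ) (h : ℝ) (x : ℝ) : Prop :=
  x ∈ Set.Icc (0 : ℝ) 1 ∧
    ∀ k ≤ r, x + ((r : ℝ) - 2 * k) * (h / 2) * phiDT x ∈ Set.Icc (0 : ℝ) 1

/-- Ditzian–Totik modulus of smoothness `ω^r_φ(f,t)`. -/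
noncomputable def omegaDT (r : ℕ) (f : ℝ → ℝ) (t : ℝ) : ℝ :=
  sSup {y | ∃ h x, 0 < h ∧ h ≤ t ∧ dtAdmissible r h x ∧ y = |dtDiff r h f x|}

/-- The set of quotients `ω^r_φ(f,t)/t^λ`, `t > 0`. -/
def zygSet (lam : ℝ) (r : ℕ) (f : ℝ → ℝ) : Set ℝ :=
  {y | ∃ t : ℝ, 0 < t ∧ y = omegaDT r f t / t ^ lam}

/-- Membership in the Hölder–Zygmund space `Z_λ` (modulus of order `r`). -/
def memZ (lam : ℝ) (r : ℕ) (f : ℝ → ℝ) : Prop :=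
  ContinuousOn f (Set.Icc 0 1) ∧ BddAbove (zygSet lam r f)

/-- The Zygmund norm `‖f‖_{Z_λ} = ‖f‖ + sup_{t>0} ω^r_φ(f,t)/t^λ`. -/
noncomputable def Znorm (lam : ℝ) (r : ℕ) (f : ℝ → ℝ) : ℝ :=
  supNorm f + sSup (zygSet lam r f)

/-- Volterra integral operator `(Vf)(s) = ∫_0^s k(t,s) f(t) (s-t)^α t^β dt`. -/
noncomputable def Vop (alp bet : ℝ) (k : ℝ → ℝ → ℝ) (f : ℝ → ℝ) (s : ℝ) : ℝ :=
  ∫ t in (0 : ℝ)..s, k t s * f t * (s - t) ^ alp * t ^ bet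

/-- Quadrature coefficients `Q^{(ℓ)}_j(s) = ∫_0^s p^{(ℓ)}_{m,j}(t)(s-t)^α t^β dt`. -/
noncomputable def Qcoef (alp bet : ℝ) (m l j : ℕ) (s : ℝ) : ℝ :=
  ∫ t in (0 : ℝ)..s, gbBasis m l j t * (s - t) ^ alp * t ^ bet

/-- Discrete Volterra operator `(V_m^{(ℓ)}f)(s) = ∑_j Q^{(ℓ)}_j(s) k(j/m,s) f(j/m)`. -/
noncomputable def Vmop (alp bet : ℝ) (k : ℝ → ℝ → ℝ) (m l : ℕ) (f : ℝ → ℝ) (s : ℝ) : ℝ :=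
  ∑ j ∈ Finset.range (m + 1),
    Qcoef alp bet m l j s * k ((j : ℝ) / (m : ℝ)) s * f ((j : ℝ) / (m : ℝ))

/-- Alternating sum `∑ (-1)^k C(r,k) f(a + kη)`: the `r`-th difference of step `η`, up to sign. -/
noncomputable def stepDiff (r : ℕ) (η : ℝ) (f : ℝ → ℝ) (a : ℝ) : ℝ :=
  ∑ k ∈ Finset.range (r + 1), (-1 : ℝ) ^ k * (r.choose k : ℝ) * f (a + k * η)

/-- All `r`-th differences of `f` with nodes in `[0,1]` are at most `ω` in absolute value. -/
def DiffBound (r : ℕ) (f : ℝ → ℝ) (ω : ℝ) : Prop :=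
  ∀ a η : ℝ, 0 ≤ a → 0 < η → a + r * η ≤ 1 → |stepDiff r η f a| ≤ ω

theorem stepDiff_sub (r : ℕ) (η : ℝ) (f g : ℝ → ℝ) (a : ℝ) :
    stepDiff r η (fun y => f y - g y) a = stepDiff r η f a - stepDiff r η g a := by
  simp only [stepDiff, ← Finset.sum_sub_distrib]
  exact Finset.sum_congr rfl fun k _ => by ring

theorem stepDiff_reflect (r : ℕ) (η : ℝ) (f : ℝ → ℝ) (a : ℝ) :
    |stepDiff r η (fun y => f (1 - y)) a| = |stepDiff r η f (1 - (a + r * η))| := by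
  have h : stepDiff r η (fun y => f (1 - y)) a
      = (-1) ^ r * stepDiff r η f (1 - (a + r * η)) := by
    simp only [stepDiff]
    rw [← Finset.sum_range_reflect, Finset.mul_sum]
    refine Finset.sum_congr rfl fun k hk => ?_
    have hk' : k ≤ r := by simpa [Nat.lt_succ_iff] using hk
    obtain ⟨j, rfl⟩ := Nat.exists_eq_add_of_le hk'
    have e1 : k + j + 1 - 1 - k = j := by omega
    have e2 : (k + j).choose j = (k + j).choose k := by
      rw [Nat.choose_symm_add]
    rw [e1, e2]
    have e3 : (1 : ℝ) - (a + (j : ℝ) * η) = 1 - (a + ((k + j : ℕ) : ℝ) * η) + k * η := by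
      push_cast; ring
    have e4 : (-1 : ℝ) ^ (k + j) * (-1) ^ k = (-1) ^ j := by
      rw [← pow_add, show k + j + k = 2 * k + j by ring, pow_add, pow_mul]; simp
    rw [e3, ← e4]; ring
  rw [h, abs_mul]; simp

theorem DiffBound.reflect {r : ℕ} {f : ℝ → ℝ} {ω : ℝ} (h : DiffBound r f ω) :
    DiffBound r (fun y => f (1 - y)) ω := fun a η ha hη h1 => by
  rw [stepDiff_reflect]
  exact h _ _ (by linarith) hη (by linarith)

theorem stepDiff_eval_eq_zero {r : ℕ} {P : Polynomial ℝ} (hP : P.degree < r) (η a : ℝ) :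
    stepDiff r η (fun y => P.eval y) a = 0 := by
  rcases Nat.eq_zero_or_pos r with rfl | hr
  · have : P = 0 := by
      rw [← Polynomial.degree_eq_bot]
      exact Nat.WithBot.lt_zero_iff.1 (by simpa using hP)
    simp [stepDiff, this]
  set Q : Polynomial ℝ := P.comp (Polynomial.C a + Polynomial.C η * Polynomial.X) with hQ
  have hd : Q.natDegree < r := by
    have h1 : P.natDegree < r := by
      rcases eq_or_ne P 0 with rfl | h0
      · simpa using hr
      · exact (Polynomial.natDegree_lt_iff_degree_lt h0).2 hP
    have h2 : (Polynomial.C a + Polynomial.C η * Polynomial.X).natDegree ≤ 1 := by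
      rw [add_comm]; exact Polynomial.natDegree_linear_le
    calc Q.natDegree ≤ P.natDegree * _ := Polynomial.natDegree_comp_le
      _ ≤ P.natDegree * 1 := Nat.mul_le_mul_left _ h2
      _ < r := by simpa using h1
  have h := congr_fun (Polynomial.fwdDiff_iter_eq_zero_of_degree_lt hd) 0
  rw [fwdDiff_iter_eq_sum_shift] at h
  have h' : stepDiff r η (fun y => P.eval y) a = (-1) ^ r * ∑ k ∈ Finset.range (r + 1),
      ((-1 : ℤ) ^ (r - k) * (r.choose k : ℤ)) • Q.eval (0 + k • (1 : ℝ)) := by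
    rw [stepDiff, Finset.mul_sum]
    refine Finset.sum_congr rfl fun k hk => ?_
    have hk' : k ≤ r := by simpa [Nat.lt_succ_iff] using hk
    obtain ⟨j, rfl⟩ := Nat.exists_eq_add_of_le hk'
    have e4 : (-1 : ℝ) ^ (k + j) * (-1) ^ j = (-1) ^ k := by
      rw [← pow_add, show k + j + j = 2 * j + k by ring, pow_add, pow_mul]; simp
    simp only [hQ, Polynomial.eval_comp, Polynomial.eval_add, Polynomial.eval_mul,
      Polynomial.eval_C, Polynomial.eval_X, zsmul_eq_mul, nsmul_eq_mul, mul_one, zero_add,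
      Nat.add_sub_cancel_left]
    push_cast
    rw [← e4, mul_comm η]; ring
  rw [h', h]; simp

theorem stepDiff_eq_add (r : ℕ) (η : ℝ) (f : ℝ → ℝ) (a : ℝ) :
    stepDiff r η f a = f a + ∑ k ∈ Finset.range r,
      (-1 : ℝ) ^ (k + 1) * (r.choose (k + 1) : ℝ) * f (a + (k + 1 : ℕ) * η) := by
  rw [stepDiff, Finset.sum_range_succ']; simp [add_comm]

theorem sum_choose_real (r : ℕ) : ∑ k ∈ Finset.range (r + 1), (r.choose k : ℝ) = 2 ^ r := by
  exact_mod_cast Nat.sum_range_choose r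

/-- A function with bounded `r`-th differences that vanishes at the first `r` points of a grid is
bounded on the grid. -/
theorem abs_grid_le {r N : ℕ} (hr : 1 ≤ r) (hN : 1 ≤ N) {f : ℝ → ℝ} {ω : ℝ} (hω : 0 ≤ ω)
    (hf : DiffBound r f ω) (h0 : ∀ j < r, f (j / N) = 0) :
    ∀ j ≤ N, |f (j / N)| ≤ (2 ^ r + 1) ^ j * ω := by
  intro j
  induction j using Nat.strong_induction_on with
  | _ j ih =>
    intro hj
    rcases lt_or_ge j r with hjr | hjr
    · rw [h0 j hjr]; simp; positivity
    obtain ⟨i, rfl⟩ := Nat.exists_eq_add_of_le hjr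
    have hNpos : (0 : ℝ) < N := by exact_mod_cast hN
    have hb := hf (i / N) (1 / N) (by positivity) (by positivity) (by
      rw [mul_one_div, ← add_div, div_le_one hNpos]; exact_mod_cast (by omega))
    rw [stepDiff, Finset.sum_range_succ] at hb
    set K : ℝ := (2 ^ r + 1) ^ (r + i - 1) * ω
    have hsum : |∑ k ∈ Finset.range r, (-1 : ℝ) ^ k * (r.choose k : ℝ) *
        f ((i : ℝ) / N + k * (1 / N))| ≤ 2 ^ r * K := by
      refine (Finset.abs_sum_le_sum_abs _ _).trans ?_
      calc _ ≤ ∑ k ∈ Finset.range r, (r.choose k : ℝ) * K := by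
            refine Finset.sum_le_sum fun k hk => ?_
            have hk' := Finset.mem_range.1 hk
            rw [abs_mul, abs_mul]
            have e : (i : ℝ) / N + k * (1 / N) = ((i + k : ℕ) : ℝ) / N := by
              push_cast; ring
            rw [e]
            have := ih (i + k) (by omega) (by omega)
            have h2 : ((2 : ℝ) ^ r + 1) ^ (i + k) ≤ (2 ^ r + 1) ^ (r + i - 1) :=
              pow_le_pow_right₀ (by have : (0:ℝ) < 2 ^ r := by positivity
                                    linarith) (by omega)
            have h3 : |f (((i + k : ℕ) : ℝ) / N)| ≤ K :=
              this.trans (mul_le_mul_of_nonneg_right h2 hω)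
            simpa using mul_le_mul_of_nonneg_left h3 (Nat.cast_nonneg (r.choose k))
        _ ≤ 2 ^ r * K := by
            rw [← Finset.sum_mul]
            refine mul_le_mul_of_nonneg_right ?_ (by positivity)
            rw [← sum_choose_real r, Finset.sum_range_succ]; simp
    have e : (i : ℝ) / N + r * (1 / N) = ((r + i : ℕ) : ℝ) / N := by push_cast; ring
    rw [e] at hb
    have hK : ω ≤ K := by
      have : (1 : ℝ) ≤ (2 ^ r + 1) ^ (r + i - 1) := one_le_pow₀ (by
        have : (0:ℝ) < 2 ^ r := by positivity
        linarith)
      simpa using mul_le_mul_of_nonneg_right this hω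
    have hlast : |f (((r + i : ℕ) : ℝ) / N)| ≤ ω + 2 ^ r * K := by
      have h1 : |(-1 : ℝ) ^ r * (r.choose r : ℝ) * f (((r + i : ℕ) : ℝ) / N)|
          = |f (((r + i : ℕ) : ℝ) / N)| := by simp [abs_mul]
      rw [← h1]
      have := abs_sub_abs_le_abs_sub
        ((-1 : ℝ) ^ r * (r.choose r : ℝ) * f (((r + i : ℕ) : ℝ) / N))
        (-∑ k ∈ Finset.range r, (-1 : ℝ) ^ k * (r.choose k : ℝ) *
        f ((i : ℝ) / N + k * (1 / N)))
      rw [abs_neg, sub_neg_eq_add, add_comm (_ * _ : ℝ)] at this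
      linarith
    calc _ ≤ ω + 2 ^ r * K := hlast
      _ ≤ (2 ^ r + 1) * K := by linarith
      _ = (2 ^ r + 1) ^ (r + i) * ω := by
        have : r + i = (r + i - 1) + 1 := by omega
        conv_rhs => rw [this, pow_succ]
        ring

theorem abs_sum_shift_sub_le {F : ℕ → ℝ} {M : ℝ} (L p : ℕ) (hF : ∀ i < L + p, |F i| ≤ M) :
    |∑ j ∈ Finset.range L, (F (j + p) - F j)| ≤ 2 * p * M := by
  have h : ∑ j ∈ Finset.range L, (F (j + p) - F j)
      = ∑ i ∈ Finset.range p, (F (L + i) - F i) := by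
    rw [Finset.sum_sub_distrib, Finset.sum_sub_distrib, sub_eq_sub_iff_add_eq_add,
      add_comm, add_comm (∑ i ∈ Finset.range p, F (L + i)), ← Finset.sum_range_add F L p,
      add_comm L p, Finset.sum_range_add F p L]
    simp [add_comm]
  rw [h]
  refine (Finset.abs_sum_le_sum_abs _ _).trans ?_
  calc _ ≤ ∑ i ∈ Finset.range p, (2 * M) := by
        refine Finset.sum_le_sum fun i hi => ?_
        have hi' := Finset.mem_range.1 hi
        have h1 := hF (L + i) (by omega)
        have h2 := hF i (by omega)
        exact (abs_sub _ _).trans (by linarith)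
    _ = 2 * p * M := by simp; ring

/-- Averaging over steps: small increments of a function with bounded `r`-th differences. -/
theorem abs_increment_le {r L : ℕ} (hr : 1 ≤ r) (hL : 2 ^ (r + 2) * r.factorial = L)
    {f : ℝ → ℝ} {ω M : ℝ} (hf : DiffBound r f ω) (hM : ∀ y ∈ Icc (0 : ℝ) 1, |f y| ≤ M)
    {s d : ℝ} (hs : 0 ≤ s) (hs' : s ≤ 1 / 2) (hd : 0 < d) (hd' : d * (1 + r * L) ≤ 1 / 2) :
    |f (s + d) - f s| ≤ 2 * ω + M / 2 := by
  have hM0 : 0 ≤ M := (abs_nonneg _).trans (hM 0 (by simp))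
  have hLpos : 0 < L := by rw [← hL]; positivity
  have hLR : (0 : ℝ) < L := by exact_mod_cast hLpos
  have hfac : (0 : ℝ) < r.factorial := by exact_mod_cast r.factorial_pos
  have hfac1 : (1 : ℝ) ≤ r.factorial := by exact_mod_cast r.factorial_pos
  set e : ℝ := d / r.factorial with he
  have hepos : 0 < e := by positivity
  have hed : e ≤ d := div_le_self hd.le hfac1
  have hde : d = r.factorial * e := by rw [he]; field_simp
  have hnode : ∀ k < r, ∀ j < L + r.factorial / (k + 1),
      s + ((k + 1 : ℕ) : ℝ) * ((j + 1 : ℝ) * e) ∈ Icc (0 : ℝ) 1 := by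
    intro k hk j hj
    refine ⟨by positivity, ?_⟩
    have hj1 : (j + 1 : ℝ) ≤ L + (r.factorial / (k + 1) : ℕ) := by exact_mod_cast hj
    have hk1 : ((k + 1 : ℕ) : ℝ) ≤ r := by exact_mod_cast hk
    have hp : ((k + 1 : ℕ) : ℝ) * (r.factorial / (k + 1) : ℕ) ≤ r.factorial := by
      exact_mod_cast Nat.mul_div_le _ _
    have : ((k + 1 : ℕ) : ℝ) * ((j + 1 : ℝ) * e) ≤ (r * L + r.factorial) * e := by
      have : ((k + 1 : ℕ) : ℝ) * (j + 1 : ℝ) ≤ r * L + r.factorial := by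
        calc _ ≤ ((k + 1 : ℕ) : ℝ) * (L + (r.factorial / (k + 1) : ℕ)) := by gcongr
          _ = ((k + 1 : ℕ) : ℝ) * L + ((k + 1 : ℕ) : ℝ) * (r.factorial / (k + 1) : ℕ) := by ring
          _ ≤ _ := by gcongr
      rw [← mul_assoc]; gcongr
    have h2 : (r * L + r.factorial) * e ≤ d * (1 + r * L) := by
      have : (r : ℝ) * L * e ≤ r * L * d := by gcongr
      nlinarith
    linarith
  have hdiff : ∀ j < L, ∀ a, (a = s ∨ a = s + d) → |stepDiff r ((j + 1 : ℝ) * e) f a| ≤ ω := by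
    intro j hj a ha
    have hj1 : (j + 1 : ℝ) ≤ L := by exact_mod_cast hj
    have h1 : (r : ℝ) * ((j + 1 : ℝ) * e) ≤ r * (L * d) := by gcongr
    refine hf a _ ?_ (by positivity) ?_
    · rcases ha with rfl | rfl <;> linarith
    · rcases ha with rfl | rfl <;> nlinarith
  have hid : (L : ℝ) * (f (s + d) - f s) =
      ∑ j ∈ Finset.range L, (stepDiff r ((j + 1 : ℝ) * e) f (s + d)
        - stepDiff r ((j + 1 : ℝ) * e) f s)
      - ∑ k ∈ Finset.range r, (-1 : ℝ) ^ (k + 1) * (r.choose (k + 1) : ℝ) *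
        ∑ j ∈ Finset.range L, (f (s + d + (k + 1 : ℕ) * ((j + 1 : ℝ) * e))
          - f (s + (k + 1 : ℕ) * ((j + 1 : ℝ) * e))) := by
    simp_rw [Finset.mul_sum]
    rw [Finset.sum_comm, ← Finset.sum_sub_distrib]
    simp_rw [stepDiff_eq_add, mul_sub, Finset.sum_sub_distrib]
    rw [← mul_sub, ← sub_eq_zero]
    simp [Finset.sum_add_distrib]
    ring
  have h1 : |∑ j ∈ Finset.range L, (stepDiff r ((j + 1 : ℝ) * e) f (s + d)
        - stepDiff r ((j + 1 : ℝ) * e) f s)| ≤ L * (2 * ω) := by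
    refine (Finset.abs_sum_le_sum_abs _ _).trans ?_
    calc _ ≤ ∑ j ∈ Finset.range L, (2 * ω) := by
          refine Finset.sum_le_sum fun j hj => ?_
          have hj' := Finset.mem_range.1 hj
          have := hdiff j hj' _ (Or.inl rfl)
          have := hdiff j hj' _ (Or.inr rfl)
          exact (abs_sub _ _).trans (by linarith)
      _ = L * (2 * ω) := by simp
  have h2 : |∑ k ∈ Finset.range r, (-1 : ℝ) ^ (k + 1) * (r.choose (k + 1) : ℝ) *
        ∑ j ∈ Finset.range L, (f (s + d + (k + 1 : ℕ) * ((j + 1 : ℝ) * e))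
          - f (s + (k + 1 : ℕ) * ((j + 1 : ℝ) * e)))| ≤ 2 ^ r * (2 * r.factorial * M) := by
    refine (Finset.abs_sum_le_sum_abs _ _).trans ?_
    calc _ ≤ ∑ k ∈ Finset.range r, (r.choose (k + 1) : ℝ) * (2 * r.factorial * M) := by
          refine Finset.sum_le_sum fun k hk => ?_
          have hk' := Finset.mem_range.1 hk
          rw [abs_mul, abs_mul, abs_pow, abs_neg, abs_one, one_pow, one_mul, Nat.abs_cast]
          refine mul_le_mul_of_nonneg_left ?_ (Nat.cast_nonneg _)
          set p := r.factorial / (k + 1) with hp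
          have hpk : (k + 1) * p = r.factorial :=
            Nat.mul_div_cancel' (Nat.dvd_factorial (by omega) (by omega))
          have hpk' : ((k + 1 : ℕ) : ℝ) * p = r.factorial := by exact_mod_cast hpk
          have := abs_sum_shift_sub_le (F := fun j : ℕ => f (s + (k + 1 : ℕ) * ((j + 1 : ℝ) * e)))
            (M := M) L p (fun i hi => hM _ (hnode k hk' i hi))
          have hple : (p : ℝ) ≤ r.factorial := by exact_mod_cast Nat.div_le_self _ _
          calc _ ≤ 2 * p * M := by
                refine le_of_eq_of_le ?_ this
                congr 1
                refine Finset.sum_congr rfl fun j _ => ?_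
                congr 2
                rw [hde, ← hpk']; push_cast; ring
            _ ≤ _ := by gcongr
      _ ≤ 2 ^ r * (2 * r.factorial * M) := by
          rw [← Finset.sum_mul]
          refine mul_le_mul_of_nonneg_right ?_ (by positivity)
          rw [← sum_choose_real r, Finset.sum_range_succ']; simp
  have h3 : (2 : ℝ) ^ r * (2 * r.factorial * M) = L * (M / 2) := by
    rw [← hL]; push_cast; ring
  have h4 : (L : ℝ) * |f (s + d) - f s| ≤ L * (2 * ω + M / 2) := by
    rw [← abs_of_pos hLR, ← abs_mul, hid, abs_of_pos hLR]
    refine (abs_sub _ _).trans ?_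
    rw [mul_add, ← h3]; exact add_le_add h1 h2
  exact le_of_mul_le_mul_left h4 hLR

/-- **Whitney's theorem** on `[0,1]`, for bounded functions. -/
theorem exists_polynomial_near (r : ℕ) (hr : 1 ≤ r) : ∃ W : ℝ, 0 < W ∧ ∀ (f : ℝ → ℝ) (ω M : ℝ),
    (∀ y ∈ Icc (0 : ℝ) 1, |f y| ≤ M) → DiffBound r f ω →
    ∃ P : Polynomial ℝ, P.degree < r ∧ ∀ y ∈ Icc (0 : ℝ) 1, |f y - P.eval y| ≤ W * ω := by
  obtain ⟨L, hL⟩ : ∃ L, 2 ^ (r + 2) * r.factorial = L := ⟨_, rfl⟩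
  set N : ℕ := 2 * (1 + r * L) with hN
  have hN1 : 1 ≤ N := by omega
  have hNR : (0 : ℝ) < N := by exact_mod_cast hN1
  set K : ℝ := (2 ^ r + 1) ^ N with hK
  have hKpos : 0 < K := by positivity
  refine ⟨2 * (K + 2), by positivity, fun f ω M₀ hM₀ hf => ?_⟩
  have hω : 0 ≤ ω := (abs_nonneg _).trans
    (hf 0 (1 / r) le_rfl (by positivity) (by field_simp; simp))
  set v : ℕ → ℝ := fun j => (j : ℝ) / N with hv
  have hinj : Set.InjOn v (Finset.range r) := by
    intro a _ b _ hab
    have : (a : ℝ) = b := by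
      simp only [hv] at hab; field_simp at hab; exact hab
    exact_mod_cast this
  set P := Lagrange.interpolate (Finset.range r) v (fun j => f (v j)) with hP
  have hPd : P.degree < r := by
    have := Lagrange.degree_interpolate_lt (fun j => f (v j)) hinj
    rwa [Finset.card_range] at this
  refine ⟨P, hPd, ?_⟩
  set g : ℝ → ℝ := fun y => f y - P.eval y with hg
  have hgd : DiffBound r g ω := fun a η ha hη h1 => by
    rw [hg, stepDiff_sub, stepDiff_eval_eq_zero hPd, sub_zero]; exact hf a η ha hη h1
  have hg0 : ∀ j < r, g ((j : ℝ) / N) = 0 := fun j hj => by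
    have := Lagrange.eval_interpolate_at_node (fun j => f (v j)) hinj (Finset.mem_range.2 hj)
    simp only [hg]; rw [hP]; simp only [hv] at this ⊢; rw [this]; simp
  have hgrid : ∀ j ≤ N, |g ((j : ℝ) / N)| ≤ K * ω := fun j hj => by
    refine (abs_grid_le hr hN1 hω hgd hg0 j hj).trans ?_
    refine mul_le_mul_of_nonneg_right (pow_le_pow_right₀ ?_ hj) hω
    have : (0 : ℝ) < 2 ^ r := by positivity
    linarith
  have hhalf : ∀ (u : ℝ → ℝ) (M : ℝ), DiffBound r u ω → (∀ y ∈ Icc (0 : ℝ) 1, |u y| ≤ M) →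
      (∀ j ≤ N, |u ((j : ℝ) / N)| ≤ K * ω) →
      ∀ y, 0 ≤ y → y ≤ 1 / 2 → |u y| ≤ (K + 2) * ω + M / 2 := by
    intro u M hu hM hgr y hy0 hy1
    have hMp : 0 ≤ M := (abs_nonneg _).trans (hM 0 (by simp))
    set j := ⌊y * N⌋₊ with hj
    have hj1 : (j : ℝ) ≤ y * N := Nat.floor_le (by positivity)
    have hj2 : y * N < j + 1 := Nat.lt_floor_add_one _
    have hjN : j ≤ N := by
      have : (j : ℝ) ≤ N := hj1.trans (by nlinarith)
      exact_mod_cast this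
    have hjy : (j : ℝ) / N ≤ y := by rwa [div_le_iff₀ hNR]
    rcases hjy.eq_or_lt with h | h
    · rw [← h]; refine (hgr j hjN).trans ?_; nlinarith
    have hd : (y - j / N) * (1 + r * L) ≤ 1 / 2 := by
      have h1 : y - j / N ≤ 1 / N := by
        rw [sub_le_iff_le_add, ← add_div, le_div_iff₀ hNR]; linarith
      have h2 : (N : ℝ) = 2 * (1 + r * L) := by rw [hN]; push_cast; ring
      have h3 : (0 : ℝ) < 1 + r * L := by positivity
      calc _ ≤ (1 / (N : ℝ)) * (1 + r * L) := by gcongr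
        _ = 1 / 2 := by rw [h2]; field_simp
    have := abs_increment_le hr hL hu hM (s := j / N) (d := y - j / N) (by positivity)
      (hjy.trans hy1) (by linarith) hd
    rw [add_sub_cancel] at this
    have h5 := hgr j hjN
    have h6 := abs_sub_abs_le_abs_sub (u y) (u (j / N))
    linarith
  have hstep : ∀ M, (∀ y ∈ Icc (0 : ℝ) 1, |g y| ≤ M) →
      ∀ y ∈ Icc (0 : ℝ) 1, |g y| ≤ (K + 2) * ω + M / 2 := by
    intro M hM y hy
    rcases le_total y (1 / 2) with h | h
    · exact hhalf g M hgd hM hgrid y hy.1 h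
    · have := hhalf (fun y => g (1 - y)) M hgd.reflect
        (fun y hy => hM _ ⟨by linarith [hy.2], by linarith [hy.1]⟩)
        (fun j hj => by
          have := hgrid (N - j) (by omega)
          rw [Nat.cast_sub hj, sub_div, div_self hNR.ne'] at this; exact this)
        (1 - y) (by linarith [hy.2]) (by linarith)
      simpa using this
  have hgb : BddAbove ((fun y => |g y|) '' Icc 0 1) := by
    obtain ⟨B, hB⟩ := (isCompact_Icc (a := (0 : ℝ)) (b := 1)).exists_bound_of_continuousOn
      (f := fun y => P.eval y) P.continuous.continuousOn
    refine ⟨M₀ + B, ?_⟩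
    rintro _ ⟨y, hy, rfl⟩
    have h1 := hM₀ y hy
    have h2 := hB y hy
    rw [Real.norm_eq_abs] at h2
    exact (abs_sub _ _).trans (by linarith)
  set M := sSup ((fun y => |g y|) '' Icc 0 1) with hMdef
  have hM : ∀ y ∈ Icc (0 : ℝ) 1, |g y| ≤ M := fun y hy => le_csSup hgb ⟨y, hy, rfl⟩
  have hMle : M ≤ (K + 2) * ω + M / 2 := by
    refine csSup_le ⟨_, 0, by simp, rfl⟩ ?_
    rintro _ ⟨y, hy, rfl⟩
    exact hstep M hM y hy
  intro y hy
  exact (hM y hy).trans (by linarith)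

/-- Weighted `ℓ¹` norm `∑_{j<r} |c_j| S^j` of the coefficients of a polynomial. -/
noncomputable def wnorm (r : ℕ) (S : ℝ) (Q : Polynomial ℝ) : ℝ :=
  ∑ j ∈ Finset.range r, |Q.coeff j| * S ^ j

theorem wnorm_nonneg (r : ℕ) {S : ℝ} (hS : 0 ≤ S) (Q : Polynomial ℝ) : 0 ≤ wnorm r S Q :=
  Finset.sum_nonneg fun _ _ => by positivity

theorem wnorm_add_le (r : ℕ) {S : ℝ} (hS : 0 ≤ S) (P Q : Polynomial ℝ) :
    wnorm r S (P + Q) ≤ wnorm r S P + wnorm r S Q := by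
  simp only [wnorm, ← Finset.sum_add_distrib]
  refine Finset.sum_le_sum fun j _ => ?_
  rw [Polynomial.coeff_add, ← add_mul]
  gcongr
  exact abs_add_le _ _

theorem wnorm_C_mul (r : ℕ) (S c : ℝ) (Q : Polynomial ℝ) :
    wnorm r S (Polynomial.C c * Q) = |c| * wnorm r S Q := by
  simp [wnorm, Finset.mul_sum, abs_mul, mul_assoc]

theorem wnorm_sub_le (r : ℕ) {S : ℝ} (hS : 0 ≤ S) (P Q : Polynomial ℝ) :
    wnorm r S (P - Q) ≤ wnorm r S P + wnorm r S Q := by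
  have h := wnorm_add_le r hS P (Polynomial.C (-1) * Q)
  rw [wnorm_C_mul] at h
  simpa [sub_eq_add_neg] using h

theorem wnorm_sum_le (r : ℕ) {S : ℝ} (hS : 0 ≤ S) {ι : Type*} (s : Finset ι)
    (Q : ι → Polynomial ℝ) : wnorm r S (∑ i ∈ s, Q i) ≤ ∑ i ∈ s, wnorm r S (Q i) := by
  classical
  induction s using Finset.induction_on with
  | empty => simp [wnorm]
  | insert a s ha ih =>
    rw [Finset.sum_insert ha, Finset.sum_insert ha]
    exact (wnorm_add_le r hS _ _).trans (by linarith)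

theorem wnorm_X_mul_le (r : ℕ) {S : ℝ} (hS : 0 ≤ S) (Q : Polynomial ℝ) :
    wnorm r S (Polynomial.X * Q) ≤ S * wnorm r S Q := by
  cases r with
  | zero => simp [wnorm]
  | succ r =>
    rw [wnorm, Finset.sum_range_succ', wnorm, Finset.sum_range_succ, mul_add, Finset.mul_sum]
    simp only [Polynomial.coeff_X_mul, Polynomial.mul_coeff_zero, Polynomial.coeff_X_zero,
      zero_mul, abs_zero, add_zero]
    have h1 : ∑ k ∈ Finset.range r, |Q.coeff k| * S ^ (k + 1)
        = ∑ k ∈ Finset.range r, S * (|Q.coeff k| * S ^ k) :=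
      Finset.sum_congr rfl fun k _ => by ring
    rw [h1]
    have : 0 ≤ S * (|Q.coeff r| * S ^ r) := by positivity
    linarith

theorem coeff_X_mul_derivative (Q : Polynomial ℝ) (i : ℕ) :
    (Polynomial.X * Polynomial.derivative Q).coeff i = i * Q.coeff i := by
  cases i with
  | zero => simp
  | succ i => rw [Polynomial.coeff_X_mul, Polynomial.coeff_derivative]; push_cast; ring

theorem wnorm_X_mul_derivative_le (r : ℕ) {S : ℝ} (hS : 0 ≤ S) (Q : Polynomial ℝ) :
    wnorm r S (Polynomial.X * Polynomial.derivative Q) ≤ r * wnorm r S Q := by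
  rw [wnorm, wnorm, Finset.mul_sum]
  refine Finset.sum_le_sum fun j hj => ?_
  have : (j : ℝ) ≤ r := by exact_mod_cast (Finset.mem_range.1 hj).le
  rw [coeff_X_mul_derivative, abs_mul, Nat.abs_cast, mul_assoc]
  gcongr

theorem wnorm_X_pow_le (r : ℕ) {S : ℝ} (hS : 0 ≤ S) (j : ℕ) :
    wnorm r S (Polynomial.X ^ j) ≤ S ^ j := by
  simp only [wnorm, Polynomial.coeff_X_pow]
  calc _ = ∑ i ∈ Finset.range r, if i = j then S ^ j else 0 :=
        Finset.sum_congr rfl fun i _ => by split_ifs with h <;> simp [h]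
    _ ≤ S ^ j := by
        rw [Finset.sum_ite_eq']; split_ifs
        · exact le_rfl
        · positivity

theorem eval_eq_sum_of_degree_lt {r : ℕ} {Q : Polynomial ℝ} (hQ : Q.degree < r) (y : ℝ) :
    Q.eval y = ∑ j ∈ Finset.range r, Q.coeff j * y ^ j := by
  rcases eq_or_ne Q 0 with rfl | h0
  · simp
  · exact Polynomial.eval_eq_sum_range' ((Polynomial.natDegree_lt_iff_degree_lt h0).2 hQ) y

theorem abs_eval_le_wnorm {r : ℕ} {Q : Polynomial ℝ} (hQ : Q.degree < r) {S y : ℝ}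
    (hy : |y| ≤ S) : |Q.eval y| ≤ wnorm r S Q := by
  rw [eval_eq_sum_of_degree_lt hQ, wnorm]
  refine (Finset.abs_sum_le_sum_abs _ _).trans (Finset.sum_le_sum fun j _ => ?_)
  rw [abs_mul, abs_pow]
  gcongr

/-- A polynomial without constant term is small near the origin. -/
theorem abs_eval_le_div_mul_wnorm {r : ℕ} {Q : Polynomial ℝ} (hQ : Q.degree < r)
    (h0 : Q.coeff 0 = 0) {S y : ℝ} (hS : 0 < S) (hy0 : 0 ≤ y) (hy : y ≤ S) :
    |Q.eval y| ≤ y / S * wnorm r S Q := by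
  rw [eval_eq_sum_of_degree_lt hQ, wnorm, Finset.mul_sum]
  refine (Finset.abs_sum_le_sum_abs _ _).trans (Finset.sum_le_sum fun j _ => ?_)
  cases j with
  | zero => simp [h0]
  | succ j =>
    rw [abs_mul, abs_pow, abs_of_nonneg hy0]
    have h1 : y ^ j ≤ S ^ j := by gcongr
    have h2 : y / S * (|Q.coeff (j + 1)| * S ^ (j + 1)) = |Q.coeff (j + 1)| * (S ^ j * y) := by
      field_simp; ring
    rw [h2, pow_succ]
    gcongr

/-- Coefficients of polynomials of degree `< r` are controlled by the sup norm on `[0,1]`. -/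
theorem exists_wnorm_one_le (r : ℕ) : ∃ C : ℝ, 0 < C ∧ ∀ (Q : Polynomial ℝ) (M : ℝ),
    Q.degree < r → (∀ y ∈ Icc (0 : ℝ) 1, |Q.eval y| ≤ M) → wnorm r 1 Q ≤ C * M := by
  set v : ℕ → ℝ := fun j => (j : ℝ) / r with hv
  set C : ℝ := ∑ i ∈ Finset.range r, wnorm r 1 (Lagrange.basis (Finset.range r) v i) with hC
  have hC0 : 0 ≤ C := Finset.sum_nonneg fun i _ => wnorm_nonneg r zero_le_one _
  refine ⟨C + 1, by positivity, fun Q M hQ hM => ?_⟩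
  have hM0 : 0 ≤ M := (abs_nonneg _).trans (hM 0 (by simp))
  rcases Nat.eq_zero_or_pos r with rfl | hr
  · simp [wnorm]; positivity
  have hrR : (0 : ℝ) < r := by exact_mod_cast hr
  have hinj : Set.InjOn v (Finset.range r) := by
    intro a _ b _ hab
    have : (a : ℝ) = b := by
      simp only [hv] at hab; field_simp at hab; exact hab
    exact_mod_cast this
  have hQi := Lagrange.eq_interpolate (f := Q) hinj (by simpa using hQ)
  have h1 : wnorm r 1 Q ≤ C * M := by
    rw [hQi, Lagrange.interpolate_apply]
    refine (wnorm_sum_le r zero_le_one _ _).trans ?_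
    rw [hC, Finset.sum_mul]
    refine Finset.sum_le_sum fun i hi => ?_
    rw [wnorm_C_mul, mul_comm]
    have hi' : (i : ℝ) ≤ r := by exact_mod_cast (Finset.mem_range.1 hi).le
    refine mul_le_mul_of_nonneg_left (hM _ ⟨by positivity, ?_⟩) (wnorm_nonneg r zero_le_one _)
    exact (div_le_one hrR).2 hi'
  linarith

theorem degree_comp_linear_lt {r : ℕ} {Q : Polynomial ℝ} (hQ : Q.degree < r) (a b : ℝ) :
    (Q.comp (Polynomial.C b * Polynomial.X + Polynomial.C a)).degree < r := by
  rcases eq_or_ne Q 0 with rfl | h0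
  · simp
  have h1 : Q.natDegree < r := (Polynomial.natDegree_lt_iff_degree_lt h0).2 hQ
  refine (Polynomial.degree_le_natDegree).trans_lt ?_
  have : (Q.comp (Polynomial.C b * Polynomial.X + Polynomial.C a)).natDegree < r :=
    calc _ ≤ Q.natDegree * _ := Polynomial.natDegree_comp_le
      _ ≤ Q.natDegree * 1 := Nat.mul_le_mul_left _ Polynomial.natDegree_linear_le
      _ < r := by simpa using h1
  exact_mod_cast this

/-- Growth of a polynomial outside an interval, and the resulting bound of its coefficients. -/
theorem exists_growth (r : ℕ) : ∃ C : ℝ, 0 < C ∧ ∀ (Q : Polynomial ℝ) (M a η : ℝ),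
    Q.degree < r → 0 < η → (∀ y ∈ Icc a (a + η), |Q.eval y| ≤ M) →
    (∀ T y : ℝ, 1 ≤ T → |y - a| ≤ T * η → |Q.eval y| ≤ C * M * T ^ (r - 1)) ∧
    (∀ S : ℝ, 0 ≤ a → a ≤ S → η ≤ S → wnorm r S Q ≤ C * M * (S / η) ^ (r - 1)) := by
  obtain ⟨C, hC, h⟩ := exists_wnorm_one_le r
  refine ⟨C + C * C, by positivity, fun Q M a η hQ hη hM => ?_⟩
  have hM0 : 0 ≤ M := (abs_nonneg _).trans (hM a ⟨le_rfl, by linarith⟩)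
  have hgrow : ∀ T y : ℝ, 1 ≤ T → |y - a| ≤ T * η → |Q.eval y| ≤ C * M * T ^ (r - 1) := by
    intro T y hT hy
    set q := Q.comp (Polynomial.C η * Polynomial.X + Polynomial.C a) with hq
    have hqd : q.degree < r := degree_comp_linear_lt hQ a η
    have hq1 : wnorm r 1 q ≤ C * M := by
      refine h q M hqd fun z hz => ?_
      rw [hq, Polynomial.eval_comp]
      simp only [Polynomial.eval_add, Polynomial.eval_mul, Polynomial.eval_C, Polynomial.eval_X]
      exact hM _ ⟨by nlinarith [hz.1], by nlinarith [hz.2]⟩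
    have hev : Q.eval y = q.eval ((y - a) / η) := by
      rw [hq, Polynomial.eval_comp]
      simp only [Polynomial.eval_add, Polynomial.eval_mul, Polynomial.eval_C, Polynomial.eval_X]
      congr 1; field_simp; ring
    have hz : |(y - a) / η| ≤ T := by
      rw [abs_div, abs_of_pos hη, div_le_iff₀ hη]; exact hy
    rw [hev]
    calc _ ≤ wnorm r T q := abs_eval_le_wnorm hqd hz
      _ ≤ T ^ (r - 1) * wnorm r 1 q := by
        rw [wnorm, wnorm, Finset.mul_sum]
        refine Finset.sum_le_sum fun j hj => ?_
        have hj' := Finset.mem_range.1 hj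
        have : T ^ j ≤ T ^ (r - 1) := pow_le_pow_right₀ hT (by omega)
        rw [one_pow, mul_one, mul_comm]
        gcongr
      _ ≤ T ^ (r - 1) * (C * M) := by gcongr
      _ = _ := by ring
  refine ⟨fun T y hT hy => (hgrow T y hT hy).trans ?_, fun S ha haS hηS => ?_⟩
  · have : 0 ≤ C * C * M * T ^ (r - 1) := by positivity
    nlinarith
  · have hS : 0 < S := hη.trans_le hηS
    have hT : 1 ≤ S / η := (one_le_div hη).2 hηS
    set q := Q.comp (Polynomial.C S * Polynomial.X) with hq
    have hqd : q.degree < r := by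
      have := degree_comp_linear_lt hQ 0 S
      simpa [hq] using this
    have h1 : wnorm r S Q = wnorm r 1 q := by
      simp [wnorm, hq, abs_mul, abs_of_pos hS]
    have h2 : wnorm r 1 q ≤ C * (C * M * (S / η) ^ (r - 1)) := by
      refine h q _ hqd fun z hz => ?_
      rw [hq, Polynomial.eval_comp]
      simp only [Polynomial.eval_mul, Polynomial.eval_C, Polynomial.eval_X]
      refine hgrow _ _ hT ?_
      rw [div_mul_cancel₀ _ hη.ne', abs_le]
      constructor <;> nlinarith [hz.1, hz.2]
    have : 0 ≤ C * M * (S / η) ^ (r - 1) := by positivity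
    rw [h1]; nlinarith

theorem eval_bernsteinPolynomial (m k : ℕ) (x : ℝ) :
    (bernsteinPolynomial ℝ m k).eval x = bern m k x := by
  simp [bernsteinPolynomial, bern]

open Polynomial in
theorem X_mul_one_sub_X_mul_derivative_bernsteinPolynomial {m k : ℕ} (hk : k ≤ m) :
    (1 - X) * (X * derivative (bernsteinPolynomial ℝ m k))
      = (C (k : ℝ) - C (m : ℝ) * X) * bernsteinPolynomial ℝ m k := by
  obtain ⟨i, rfl⟩ := Nat.exists_eq_add_of_le hk
  have h1 : X * derivative ((X : ℝ[X]) ^ k) = C (k : ℝ) * X ^ k := by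
    cases k with
    | zero => simp
    | succ k => rw [derivative_X_pow]; simp; ring
  have h2 : (1 - X) * derivative ((1 - X : ℝ[X]) ^ i) = -(C (i : ℝ) * (1 - X) ^ i) := by
    cases i with
    | zero => simp
    | succ i => rw [derivative_pow]; simp; ring
  have h3 : bernsteinPolynomial ℝ (k + i) k
      = C ((k + i).choose k : ℝ) * (X ^ k * (1 - X) ^ i) := by
    simp [bernsteinPolynomial, mul_assoc]
  rw [h3, derivative_C_mul, derivative_mul]
  calc _ = C ((k + i).choose k : ℝ) * ((X * derivative ((X : ℝ[X]) ^ k)) * (1 - X) * (1 - X) ^ i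
        + X * X ^ k * ((1 - X) * derivative ((1 - X : ℝ[X]) ^ i))) := by ring
    _ = _ := by rw [h1, h2]; push_cast; simp only [map_add]; ring

/-- The polynomial `x^j - B_m(t^j, x)`. -/
noncomputable def bernDefect (m j : ℕ) : Polynomial ℝ :=
  Polynomial.X ^ j - ∑ k ∈ Finset.range (m + 1),
    Polynomial.C (((k : ℝ) / m) ^ j) * bernsteinPolynomial ℝ m k

theorem eval_bernDefect (m j : ℕ) (y : ℝ) :
    (bernDefect m j).eval y = y ^ j - Bop m (fun z => z ^ j) y := by
  simp [bernDefect, Bop, Polynomial.eval_finsetSum, eval_bernsteinPolynomial, mul_comm]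

theorem bernDefect_zero (m : ℕ) : bernDefect m 0 = 0 := by
  simp [bernDefect, bernsteinPolynomial.sum]

open Polynomial in
theorem bernDefect_succ {m : ℕ} (hm : 1 ≤ m) (j : ℕ) :
    bernDefect m (j + 1) = X * bernDefect m j
      - C (1 / (m : ℝ)) * ((1 - X) * (X * derivative (X ^ j - bernDefect m j))) := by
  have hm' : (m : ℝ) ≠ 0 := by positivity
  simp only [bernDefect, sub_sub_cancel, derivative_sum, derivative_C_mul, Finset.mul_sum, mul_sub]
  rw [pow_succ', sub_sub, ← Finset.sum_add_distrib]
  congr 1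
  refine Finset.sum_congr rfl fun k hk => ?_
  have h := X_mul_one_sub_X_mul_derivative_bernsteinPolynomial
    (m := m) (k := k) (by simpa [Nat.lt_succ_iff] using hk)
  have hC : C ((k : ℝ) / m) = C (1 / (m : ℝ)) * C (k : ℝ) := by
    rw [← C_mul]; congr 1; ring
  have hC1 : C (1 / (m : ℝ)) * C (m : ℝ) = 1 := by
    rw [← C_mul, one_div_mul_cancel hm', C_1]
  calc _ = C (((k : ℝ) / m) ^ j) * (C ((k : ℝ) / m) * bernsteinPolynomial ℝ m k) := by
        rw [pow_succ, C_mul]; ring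
    _ = C (((k : ℝ) / m) ^ j) * (X * bernsteinPolynomial ℝ m k + C (1 / (m : ℝ)) *
        ((C (k : ℝ) - C (m : ℝ) * X) * bernsteinPolynomial ℝ m k)) := by
        rw [hC]; congr 1
        linear_combination (X * bernsteinPolynomial ℝ m k) * hC1
    _ = _ := by rw [← h]; ring

theorem coeff_zero_bernDefect {m : ℕ} (hm : 1 ≤ m) (j : ℕ) : (bernDefect m j).coeff 0 = 0 := by
  cases j with
  | zero => simp [bernDefect_zero]
  | succ j => rw [bernDefect_succ hm]; simp [Polynomial.mul_coeff_zero]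

theorem natDegree_bernDefect_le {m : ℕ} (hm : 1 ≤ m) (j : ℕ) : (bernDefect m j).natDegree ≤ j := by
  induction j with
  | zero => simp [bernDefect_zero]
  | succ j ih =>
    rw [bernDefect_succ hm]
    have h0 : (Polynomial.X ^ j - bernDefect m j).natDegree ≤ j :=
      (Polynomial.natDegree_sub_le _ _).trans (by simp [ih])
    have h1 : (Polynomial.X * Polynomial.derivative
        (Polynomial.X ^ j - bernDefect m j)).natDegree ≤ j := by
      rw [Polynomial.natDegree_le_iff_coeff_eq_zero]
      intro N hN
      rw [coeff_X_mul_derivative, Polynomial.coeff_eq_zero_of_natDegree_lt (by omega), mul_zero]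
    have h2 : (1 - Polynomial.X : Polynomial ℝ).natDegree ≤ 1 :=
      (Polynomial.natDegree_sub_le _ _).trans (by simp)
    refine (Polynomial.natDegree_sub_le _ _).trans (max_le ?_ ?_)
    · refine Polynomial.natDegree_mul_le.trans ?_
      rw [Polynomial.natDegree_X]; omega
    · refine (Polynomial.natDegree_C_mul_le _ _).trans (Polynomial.natDegree_mul_le.trans ?_)
      omega

theorem exists_wnorm_bernDefect_le (r j : ℕ) {A : ℝ} (hA : 0 ≤ A) : ∃ C : ℝ, 0 ≤ C ∧
    ∀ (m : ℕ) (S : ℝ), 1 ≤ m → 1 ≤ m * S → S ≤ A →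
      wnorm r S (bernDefect m j) ≤ C / (m * S) * S ^ j := by
  induction j with
  | zero => exact ⟨0, le_rfl, fun m S _ _ _ => by simp [bernDefect_zero, wnorm]⟩
  | succ j ih =>
    obtain ⟨C, hC, h⟩ := ih
    refine ⟨C + (1 + A) * (r * (1 + C)), by positivity, fun m S hm hmS hSA => ?_⟩
    have hmR : (0 : ℝ) < m := by exact_mod_cast hm
    have hS : 0 < S := by
      by_contra hn
      have : (m : ℝ) * S ≤ 0 := mul_nonpos_of_nonneg_of_nonpos hmR.le (not_lt.1 hn)
      linarith
    have hE := h m S hm hmS hSA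
    set w := wnorm r S (bernDefect m j)
    have h1 : wnorm r S (Polynomial.X ^ j - bernDefect m j) ≤ S ^ j + w :=
      (wnorm_sub_le r hS.le _ _).trans (by linarith [wnorm_X_pow_le r hS.le j])
    have hw : w ≤ C * S ^ j := hE.trans (by
      have : C / (m * S) ≤ C := div_le_self hC hmS
      gcongr)
    set G := Polynomial.X * Polynomial.derivative (Polynomial.X ^ j - bernDefect m j) with hG
    have h2 : wnorm r S G ≤ r * ((1 + C) * S ^ j) :=
      (wnorm_X_mul_derivative_le r hS.le _).trans (by gcongr; linarith)
    have h3 : wnorm r S ((1 - Polynomial.X) * G) ≤ (1 + A) * (r * ((1 + C) * S ^ j)) := by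
      rw [sub_mul, one_mul]
      refine (wnorm_sub_le r hS.le _ _).trans ?_
      have := wnorm_X_mul_le r hS.le G
      have h0 := wnorm_nonneg r hS.le G
      have : S * wnorm r S G ≤ A * wnorm r S G := by gcongr
      calc _ ≤ (1 + A) * wnorm r S G := by linarith
        _ ≤ _ := by gcongr
    rw [bernDefect_succ hm]
    refine (wnorm_sub_le r hS.le _ _).trans ?_
    rw [wnorm_C_mul, abs_of_pos (by positivity : 0 < 1 / (m : ℝ))]
    have h4 := wnorm_X_mul_le r hS.le (bernDefect m j)
    calc _ ≤ S * (C / (m * S) * S ^ j) + 1 / (m : ℝ) * ((1 + A) * (r * ((1 + C) * S ^ j))) := by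
          refine add_le_add (h4.trans ?_) ?_ <;> gcongr
      _ = _ := by field_simp; ring

/-- The polynomial `Q - B_m Q`, for `Q` of degree `< r`. -/
noncomputable def bernResidual (r m : ℕ) (Q : Polynomial ℝ) : Polynomial ℝ :=
  ∑ j ∈ Finset.range r, Polynomial.C (Q.coeff j) * bernDefect m j

theorem degree_bernResidual_lt (r : ℕ) {m : ℕ} (hm : 1 ≤ m) (Q : Polynomial ℝ) :
    (bernResidual r m Q).degree < r := by
  rw [← Polynomial.mem_degreeLT]
  refine Submodule.sum_mem _ fun j hj => ?_
  rw [Polynomial.mem_degreeLT]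
  have hj' := Finset.mem_range.1 hj
  have h1 : (Polynomial.C (Q.coeff j) * bernDefect m j).natDegree < r :=
    ((Polynomial.natDegree_C_mul_le _ _).trans (natDegree_bernDefect_le hm j)).trans_lt hj'
  exact Polynomial.degree_le_natDegree.trans_lt (by exact_mod_cast h1)

theorem coeff_zero_bernResidual (r : ℕ) {m : ℕ} (hm : 1 ≤ m) (Q : Polynomial ℝ) :
    (bernResidual r m Q).coeff 0 = 0 := by
  simp [bernResidual, coeff_zero_bernDefect hm]

theorem eval_bernResidual {r m : ℕ} {Q : Polynomial ℝ} (hQ : Q.degree < r) :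
    (fun y => (bernResidual r m Q).eval y) = (fun y => Q.eval y) - Bop m (fun y => Q.eval y) := by
  funext y
  simp only [bernResidual, Polynomial.eval_finsetSum, Polynomial.eval_mul, Polynomial.eval_C,
    eval_bernDefect, Pi.sub_apply, Bop, eval_eq_sum_of_degree_lt hQ, mul_sub,
    Finset.sum_sub_distrib, Finset.mul_sum]
  congr 1
  rw [Finset.sum_comm]
  exact Finset.sum_congr rfl fun k _ => Finset.sum_congr rfl fun j _ => by ring

theorem iterate_eval_eq {r m : ℕ} (hm : 1 ≤ m) {Q : Polynomial ℝ} (hQ : Q.degree < r) (l : ℕ) :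
    ((bernResidual r m)^[l] Q).degree < r ∧
    (fun g => g - Bop m g)^[l] (fun y => Q.eval y)
      = fun y => ((bernResidual r m)^[l] Q).eval y := by
  induction l with
  | zero => exact ⟨hQ, rfl⟩
  | succ l ih =>
    rw [Function.iterate_succ_apply', Function.iterate_succ_apply', ih.2, eval_bernResidual ih.1]
    exact ⟨degree_bernResidual_lt r hm _, rfl⟩

theorem exists_wnorm_iterate_le (r l : ℕ) {A : ℝ} (hA : 0 ≤ A) : ∃ C : ℝ, 0 < C ∧
    ∀ (m : ℕ) (S : ℝ) (Q : Polynomial ℝ), 1 ≤ m → 1 ≤ m * S → S ≤ A →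
      wnorm r S ((bernResidual r m)^[l] Q) ≤ (C / (m * S)) ^ l * wnorm r S Q := by
  choose C hC h using fun j => exists_wnorm_bernDefect_le r j hA
  refine ⟨1 + ∑ j ∈ Finset.range r, C j, by
    have := Finset.sum_nonneg fun j (_ : j ∈ Finset.range r) => hC j
    linarith, fun m S Q hm hmS hSA => ?_⟩
  set K := 1 + ∑ j ∈ Finset.range r, C j with hK
  have hmR : (0 : ℝ) < m := by exact_mod_cast hm
  have hS : 0 < S := by
    by_contra hn
    have : (m : ℝ) * S ≤ 0 := mul_nonpos_of_nonneg_of_nonpos hmR.le (not_lt.1 hn)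
    linarith
  have hKC : ∀ j < r, C j ≤ K := fun j hj => by
    have := Finset.single_le_sum (fun j _ => hC j) (Finset.mem_range.2 hj)
    linarith
  have hK0 : 0 ≤ K := by
    have := Finset.sum_nonneg fun j (_ : j ∈ Finset.range r) => hC j
    linarith
  have hone : ∀ P : Polynomial ℝ, wnorm r S (bernResidual r m P) ≤ K / (m * S) * wnorm r S P := by
    intro P
    refine (wnorm_sum_le r hS.le _ _).trans ?_
    conv_rhs => rw [wnorm, Finset.mul_sum]
    refine Finset.sum_le_sum fun j hj => ?_
    rw [wnorm_C_mul]
    calc _ ≤ |P.coeff j| * (C j / (m * S) * S ^ j) := by gcongr; exact h j m S hm hmS hSA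
      _ ≤ |P.coeff j| * (K / (m * S) * S ^ j) := by
        have := hKC j (Finset.mem_range.1 hj)
        gcongr
      _ = _ := by ring
  induction l with
  | zero => simp
  | succ l ih =>
    rw [Function.iterate_succ_apply']
    calc _ ≤ K / (m * S) * ((K / (m * S)) ^ l * wnorm r S Q) := (hone _).trans (by gcongr)
      _ = _ := by ring

/-- `(I - B_m)^l` on polynomials of degree `< r`, on the scale `[0,S]`. -/
theorem exists_abs_iterate_eval_le (r : ℕ) {l : ℕ} (hl : 1 ≤ l) {A : ℝ} (hA : 0 ≤ A) :
    ∃ C : ℝ, 0 < C ∧ ∀ (m : ℕ) (S y : ℝ) (Q : Polynomial ℝ), 1 ≤ m → 1 ≤ m * S → S ≤ A →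
      Q.degree < r → 0 ≤ y → y ≤ S →
      |((fun g => g - Bop m g)^[l] (fun y => Q.eval y)) y|
        ≤ y / S * (C / (m * S) ^ l * wnorm r S Q) := by
  obtain ⟨C, hC, h⟩ := exists_wnorm_iterate_le r l hA
  refine ⟨C ^ l, by positivity, fun m S y Q hm hmS hSA hQ hy0 hy => ?_⟩
  have hmR : (0 : ℝ) < m := by exact_mod_cast hm
  have hS : 0 < S := by
    by_contra hn
    have : (m : ℝ) * S ≤ 0 := mul_nonpos_of_nonneg_of_nonpos hmR.le (not_lt.1 hn)
    linarith
  obtain ⟨hd, he⟩ := iterate_eval_eq hm hQ l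
  have h0 : ((bernResidual r m)^[l] Q).coeff 0 = 0 := by
    obtain ⟨k, rfl⟩ := Nat.exists_eq_add_of_le' hl
    rw [Function.iterate_succ_apply', coeff_zero_bernResidual r hm]
  rw [he, ← div_pow]
  refine (abs_eval_le_div_mul_wnorm hd h0 hS hy0 hy).trans ?_
  exact mul_le_mul_of_nonneg_left (h m S Q hm hmS hSA) (by positivity)

theorem bern_nonneg (m k : ℕ) {x : ℝ} (hx : x ∈ Icc (0 : ℝ) 1) : 0 ≤ bern m k x := by
  have h0 := hx.1
  have h1 : 0 ≤ 1 - x := by linarith [hx.2]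
  unfold bern; positivity

theorem sum_bern (m : ℕ) (x : ℝ) : ∑ k ∈ Finset.range (m + 1), bern m k x = 1 := by
  have := congr_arg (Polynomial.eval x) (bernsteinPolynomial.sum ℝ m)
  simpa [Polynomial.eval_finsetSum, eval_bernsteinPolynomial] using this

theorem node_mem {m k : ℕ} (hk : k ∈ Finset.range (m + 1)) : (k : ℝ) / m ∈ Icc (0 : ℝ) 1 := by
  have hk' : (k : ℝ) ≤ m := by exact_mod_cast Nat.lt_succ_iff.1 (Finset.mem_range.1 hk)
  exact ⟨by positivity, div_le_one_of_le₀ hk' (by positivity)⟩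

theorem Bop_mono (m : ℕ) {f g : ℝ → ℝ} (h : ∀ y ∈ Icc (0 : ℝ) 1, f y ≤ g y) {x : ℝ}
    (hx : x ∈ Icc (0 : ℝ) 1) : Bop m f x ≤ Bop m g x :=
  Finset.sum_le_sum fun k hk =>
    mul_le_mul_of_nonneg_left (h _ (node_mem hk)) (bern_nonneg m k hx)

theorem abs_Bop_le (m : ℕ) {f g : ℝ → ℝ} (h : ∀ y ∈ Icc (0 : ℝ) 1, |f y| ≤ g y) {x : ℝ}
    (hx : x ∈ Icc (0 : ℝ) 1) : |Bop m f x| ≤ Bop m g x := by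
  refine (Finset.abs_sum_le_sum_abs _ _).trans (Finset.sum_le_sum fun k hk => ?_)
  rw [abs_mul, abs_of_nonneg (bern_nonneg m k hx)]
  exact mul_le_mul_of_nonneg_left (h _ (node_mem hk)) (bern_nonneg m k hx)

theorem Bop_const_mul (m : ℕ) (c : ℝ) (f : ℝ → ℝ) (x : ℝ) :
    Bop m (fun y => c * f y) x = c * Bop m f x := by
  simp only [Bop, Finset.mul_sum]
  exact Finset.sum_congr rfl fun k _ => by ring

theorem Bop_add (m : ℕ) (f g : ℝ → ℝ) (x : ℝ) :
    Bop m (fun y => f y + g y) x = Bop m f x + Bop m g x := by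
  simp only [Bop, ← Finset.sum_add_distrib, mul_add]

theorem Bop_const (m : ℕ) (c x : ℝ) : Bop m (fun _ => c) x = c := by
  simp only [Bop, ← Finset.sum_mul, sum_bern, one_mul]

/-- Exponential moments of the binomial distribution. -/
theorem Bop_exp_le {m : ℕ} (hm : 1 ≤ m) {y lam : ℝ} (hy : y ∈ Icc (0 : ℝ) 1)
    (hlam : |lam| ≤ m) :
    Bop m (fun z => Real.exp (lam * (z - y))) y ≤ Real.exp (lam ^ 2 * y / m) := by
  have hmR : (0 : ℝ) < m := by exact_mod_cast hm
  obtain ⟨hy0, hy1⟩ := hy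
  set s := lam / m with hs
  have hs1 : |s| ≤ 1 := by
    rw [hs, abs_div, abs_of_pos hmR]; exact (div_le_one hmR).2 hlam
  have hquad : ∀ u : ℝ, |u| ≤ 1 → Real.exp u ≤ 1 + u + u ^ 2 := fun u hu => by
    have := Real.abs_exp_sub_one_sub_id_le hu
    linarith [(abs_le.1 this).2]
  have h1 := hquad (s * (1 - y)) (by
    rw [abs_mul, abs_of_nonneg (by linarith : 0 ≤ 1 - y)]
    exact mul_le_one₀ hs1 (by linarith) (by linarith))
  have h2 := hquad (-(s * y)) (by
    rw [abs_neg, abs_mul, abs_of_nonneg hy0]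
    exact mul_le_one₀ hs1 hy0 hy1)
  have hsum : Bop m (fun z => Real.exp (lam * (z - y))) y
      = (y * Real.exp (s * (1 - y)) + (1 - y) * Real.exp (-(s * y))) ^ m := by
    rw [add_pow, Bop]
    refine Finset.sum_congr rfl fun k hk => ?_
    have hk' : k ≤ m := Nat.lt_succ_iff.1 (Finset.mem_range.1 hk)
    have hexp : Real.exp (lam * ((k : ℝ) / m - y))
        = Real.exp (s * (1 - y)) ^ k * Real.exp (-(s * y)) ^ (m - k) := by
      rw [← Real.exp_nat_mul, ← Real.exp_nat_mul, ← Real.exp_add, Nat.cast_sub hk', hs]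
      congr 1; field_simp; ring
    rw [hexp, bern, mul_pow, mul_pow]; ring
  rw [hsum]
  have hbase : y * Real.exp (s * (1 - y)) + (1 - y) * Real.exp (-(s * y))
      ≤ Real.exp (s ^ 2 * y) := by
    have h3 := Real.add_one_le_exp (s ^ 2 * y)
    have h4 : y * Real.exp (s * (1 - y)) ≤ y * (1 + s * (1 - y) + (s * (1 - y)) ^ 2) := by gcongr
    have h5 : (1 - y) * Real.exp (-(s * y)) ≤ (1 - y) * (1 + -(s * y) + (-(s * y)) ^ 2) :=
      mul_le_mul_of_nonneg_left h2 (by linarith)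
    have h6 : y * (1 + s * (1 - y) + (s * (1 - y)) ^ 2)
        + (1 - y) * (1 + -(s * y) + (-(s * y)) ^ 2) = 1 + s ^ 2 * y - s ^ 2 * y ^ 2 := by ring
    nlinarith [mul_nonneg (sq_nonneg s) (sq_nonneg y)]
  calc _ ≤ Real.exp (s ^ 2 * y) ^ m := by
        have : 0 ≤ 1 - y := by linarith
        gcongr
    _ = _ := by
        rw [← Real.exp_nat_mul, hs]; congr 1; field_simp

theorem Bop_central_moment_le {m : ℕ} (hm : 1 ≤ m) (l : ℕ) {y H : ℝ} (hy : y ∈ Icc (0 : ℝ) 1)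
    (hH : 1 / m ≤ H) (hyH : y ≤ m * H ^ 2) :
    Bop m (fun z => ((z - y) / H) ^ (2 * l)) y ≤ (2 * l).factorial * (2 * Real.exp 1) := by
  have hmR : (0 : ℝ) < m := by exact_mod_cast hm
  have hHp : 0 < H := lt_of_lt_of_le (by positivity) hH
  have hl1 : |1 / H| ≤ m := by
    rw [abs_of_pos (by positivity)]
    rw [div_le_iff₀ hmR] at hH
    rw [div_le_iff₀ hHp]; linarith
  have hq : (1 / H) ^ 2 * y / m ≤ 1 := by
    rw [div_pow, one_pow, div_mul_eq_mul_div, one_mul, div_div, div_le_one (by positivity)]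
    linarith
  have hp := (Bop_exp_le hm hy hl1).trans (Real.exp_le_exp.2 hq)
  have hn : Bop m (fun z => Real.exp (-(1 / H) * (z - y))) y ≤ Real.exp 1 :=
    (Bop_exp_le hm hy (by rwa [abs_neg])).trans (Real.exp_le_exp.2 (by rw [neg_sq]; exact hq))
  calc _ ≤ Bop m (fun z => (2 * l).factorial * (Real.exp (1 / H * (z - y))
        + Real.exp (-(1 / H) * (z - y)))) y := by
        refine Bop_mono m (fun z _ => ?_) hy
        have h1 := Real.pow_div_factorial_le_exp _ (abs_nonneg ((z - y) / H)) (2 * l)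
        have hf : (0 : ℝ) < (2 * l).factorial := by exact_mod_cast Nat.factorial_pos _
        rw [div_le_iff₀ hf, pow_mul, sq_abs, ← pow_mul, mul_comm (Real.exp _)] at h1
        refine h1.trans (mul_le_mul_of_nonneg_left ?_ hf.le)
        have e1 : 1 / H * (z - y) = (z - y) / H := by ring
        have e2 : -(1 / H) * (z - y) = -((z - y) / H) := by ring
        rw [e1, e2]
        have p1 := Real.exp_pos ((z - y) / H)
        have p2 := Real.exp_pos (-((z - y) / H))
        rcases abs_choice ((z - y) / H) with h | h <;> rw [h] <;> linarith
    _ = (2 * l).factorial * (Bop m (fun z => Real.exp (1 / H * (z - y))) y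
        + Bop m (fun z => Real.exp (-(1 / H) * (z - y))) y) := by
        rw [Bop_const_mul, Bop_add]
    _ ≤ _ := by gcongr; linarith

theorem add_pow_even_le (a b : ℝ) (l : ℕ) :
    (a + b) ^ (2 * l) ≤ 2 ^ (2 * l) * (a ^ (2 * l) + b ^ (2 * l)) := by
  have h1 : (a + b) ^ (2 * l) ≤ (2 * max |a| |b|) ^ (2 * l) := by
    rw [← (even_two_mul l).pow_abs (a + b)]
    have : |a + b| ≤ 2 * max |a| |b| :=
      (abs_add_le a b).trans (by linarith [le_max_left |a| |b|, le_max_right |a| |b|])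
    gcongr
  refine h1.trans ?_
  rw [mul_pow]
  have hb := (even_two_mul l).pow_nonneg b
  have ha := (even_two_mul l).pow_nonneg a
  refine mul_le_mul_of_nonneg_left ?_ (by positivity)
  rcases max_choice |a| |b| with h | h <;> rw [h, (even_two_mul l).pow_abs] <;> linarith

/-- The weight `1 + ((y-x)/h)^{2l}` is stable under `B_m` if `h` is at least of the order of the
local scale of `B_m` at `x`. -/
theorem exists_Bop_weight_le (l : ℕ) : ∃ C : ℝ, 0 < C ∧ ∀ (m : ℕ) (x h : ℝ), 1 ≤ m →
    1 / m ≤ h → x ≤ m * h ^ 2 → ∀ y ∈ Icc (0 : ℝ) 1,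
      Bop m (fun z => 1 + ((z - x) / h) ^ (2 * l)) y ≤ C * (1 + ((y - x) / h) ^ (2 * l)) := by
  set K : ℝ := (2 * l).factorial * (2 * Real.exp 1) with hK
  have hKp : 0 < K := by positivity
  refine ⟨1 + 2 ^ (2 * l) * (K * 2 ^ (2 * l) + 1), by positivity, fun m x h hm hh hx y hy => ?_⟩
  have hmR : (0 : ℝ) < m := by exact_mod_cast hm
  have hhp : 0 < h := lt_of_lt_of_le (by positivity) hh
  set H := h + |y - x| with hH
  have hHp : 0 < H := by positivity
  have hmh : 1 ≤ m * h := by rw [div_le_iff₀ hmR] at hh; linarith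
  have hmom := Bop_central_moment_le hm l (H := H) hy
    (hh.trans (by rw [hH]; linarith [abs_nonneg (y - x)])) (by
      have h1 : y ≤ x + |y - x| := by linarith [le_abs_self (y - x)]
      have h2 : |y - x| ≤ m * h * |y - x| := le_mul_of_one_le_left (abs_nonneg _) hmh
      have h3 : 0 ≤ (m : ℝ) * |y - x| ^ 2 := by positivity
      have h4 : (m : ℝ) * H ^ 2
          = m * h ^ 2 + 2 * (m * h * |y - x|) + m * |y - x| ^ 2 := by rw [hH]; ring
      linarith [abs_nonneg (y - x)])
  set u := ((y - x) / h) ^ (2 * l) with hu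
  have hu0 : 0 ≤ u := (even_two_mul l).pow_nonneg _
  have hHu : (H / h) ^ (2 * l) ≤ 2 ^ (2 * l) * (1 + u) := by
    have h1 : H / h = 1 + |(y - x) / h| := by
      rw [hH, abs_div, abs_of_pos hhp]; field_simp
    rw [h1]
    refine (add_pow_even_le _ _ _).trans ?_
    rw [(even_two_mul l).pow_abs, one_pow]
  have hpt : Bop m (fun z => ((z - x) / h) ^ (2 * l)) y
      ≤ 2 ^ (2 * l) * ((H / h) ^ (2 * l) * K + u) := by
    calc _ ≤ Bop m (fun z => 2 ^ (2 * l) * ((H / h) ^ (2 * l) * ((z - y) / H) ^ (2 * l) + u)) y := by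
          refine Bop_mono m (fun z _ => ?_) hy
          have h1 : (z - x) / h = H / h * ((z - y) / H) + (y - x) / h := by field_simp; ring
          rw [h1, ← mul_pow]; exact add_pow_even_le _ _ _
      _ = 2 ^ (2 * l) * ((H / h) ^ (2 * l) * Bop m (fun z => ((z - y) / H) ^ (2 * l)) y + u) := by
          rw [Bop_const_mul, Bop_add, Bop_const_mul, Bop_const]
      _ ≤ _ := by gcongr
  rw [Bop_add, Bop_const]
  have h5 : 2 ^ (2 * l) * ((H / h) ^ (2 * l) * K + u)
      ≤ 2 ^ (2 * l) * (2 ^ (2 * l) * (1 + u) * K + u) := by gcongr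
  have h6 : (0 : ℝ) < 2 ^ (2 * l) := by positivity
  nlinarith

/-- Iterates of `I - B_m` respect a weight that is stable under `B_m`. -/
theorem abs_iterate_sub_Bop_le {m : ℕ} {C c : ℝ} {w g : ℝ → ℝ}
    (hc : 0 ≤ c) (hC : 0 ≤ C) (hw : ∀ y ∈ Icc (0 : ℝ) 1, Bop m w y ≤ C * w y)
    (hg : ∀ y ∈ Icc (0 : ℝ) 1, |g y| ≤ c * w y) (l : ℕ) :
    ∀ y ∈ Icc (0 : ℝ) 1, |((fun g => g - Bop m g)^[l] g) y| ≤ c * (1 + C) ^ l * w y := by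
  induction l with
  | zero => simpa using hg
  | succ l ih =>
    intro y hy
    rw [Function.iterate_succ_apply']
    set G := (fun g => g - Bop m g)^[l] g
    have h1 := abs_Bop_le m ih hy
    rw [Bop_const_mul] at h1
    have h2 : c * (1 + C) ^ l * Bop m w y ≤ c * (1 + C) ^ l * (C * w y) :=
      mul_le_mul_of_nonneg_left (hw y hy) (by positivity)
    calc |(G - Bop m G) y| ≤ |G y| + |Bop m G y| := abs_sub _ _
      _ ≤ c * (1 + C) ^ l * w y + c * (1 + C) ^ l * (C * w y) := by linarith [ih y hy]
      _ = _ := by ring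

theorem iterate_sub_Bop_add (m l : ℕ) (f g : ℝ → ℝ) :
    (fun g => g - Bop m g)^[l] (f + g)
      = (fun g => g - Bop m g)^[l] f + (fun g => g - Bop m g)^[l] g := by
  induction l with
  | zero => rfl
  | succ l ih =>
    simp only [Function.iterate_succ_apply', ih]
    funext x
    simp only [Pi.sub_apply, Pi.add_apply]
    have := Bop_add m ((fun g => g - Bop m g)^[l] f) ((fun g => g - Bop m g)^[l] g) x
    have e : ((fun g => g - Bop m g)^[l] f + (fun g => g - Bop m g)^[l] g)
      = fun y => ((fun g => g - Bop m g)^[l] f) y + ((fun g => g - Bop m g)^[l] g) y := rfl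
    rw [e, this]; ring

/-- **Whitney's theorem** on an arbitrary interval, with a constant independent of the interval. -/
theorem exists_polynomial_near_Icc (r : ℕ) (hr : 1 ≤ r) : ∃ W : ℝ, 0 < W ∧
    ∀ (f : ℝ → ℝ) (ω M a b : ℝ), a < b → (∀ y ∈ Icc a b, |f y| ≤ M) →
    (∀ s η, a ≤ s → 0 < η → s + r * η ≤ b → |stepDiff r η f s| ≤ ω) →
    ∃ P : Polynomial ℝ, P.degree < r ∧ ∀ y ∈ Icc a b, |f y - P.eval y| ≤ W * ω := by
  obtain ⟨W, hW, h⟩ := exists_polynomial_near r hr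
  refine ⟨W, hW, fun f ω M a b hab hM hd => ?_⟩
  have hba : 0 < b - a := sub_pos.2 hab
  obtain ⟨Q, hQ, hQf⟩ := h (fun s => f (a + (b - a) * s)) ω M
    (fun s hs => hM _ ⟨by nlinarith [hs.1], by nlinarith [hs.2]⟩)
    (fun s η hs hη h1 => by
      have e : stepDiff r η (fun s => f (a + (b - a) * s)) s
          = stepDiff r ((b - a) * η) f (a + (b - a) * s) := by
        simp only [stepDiff]
        exact Finset.sum_congr rfl fun k _ => by ring_nf
      rw [e]
      exact hd _ _ (by nlinarith) (by positivity) (by nlinarith))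
  refine ⟨_, degree_comp_linear_lt hQ (-a / (b - a)) (1 / (b - a)), fun y hy => ?_⟩
  have h1 := hQf ((y - a) / (b - a))
    ⟨div_nonneg (by linarith [hy.1]) hba.le, (div_le_one hba).2 (by linarith [hy.2])⟩
  have e1 : a + (b - a) * ((y - a) / (b - a)) = y := by field_simp; ring
  have e2 : 1 / (b - a) * y + -a / (b - a) = (y - a) / (b - a) := by ring
  rw [Polynomial.eval_comp]
  simp only [Polynomial.eval_add, Polynomial.eval_mul, Polynomial.eval_C, Polynomial.eval_X]
  rw [e2]; rwa [e1] at h1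

/-- All differences `Δ^{2l}_{hφ} f` with `h ≤ 1/√m` are at most `ω` in absolute value. -/
def DTBound (l m : ℕ) (f : ℝ → ℝ) (ω : ℝ) : Prop :=
  ∀ a η : ℝ, 0 ≤ a → 0 < η → a + (2 * l : ℕ) * η ≤ 1 → η ≤ phiDT (a + l * η) / Real.sqrt m →
    |stepDiff (2 * l) η f a| ≤ ω

/-- The grid points `(3/4) (k/n)²` of `[0, 3/4]`. -/
noncomputable def grid (n k : ℕ) : ℝ := 3 / 4 * (k : ℝ) ^ 2 / (n : ℝ) ^ 2

theorem grid_nonneg (n k : ℕ) : 0 ≤ grid n k := by unfold grid; positivity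

theorem grid_mono (n : ℕ) {j k : ℕ} (h : j ≤ k) : grid n j ≤ grid n k := by
  unfold grid; gcongr

theorem grid_sub (n j k : ℕ) :
    grid n k - grid n j = 3 / 4 * (((k : ℝ) - j) * (k + j)) / (n : ℝ) ^ 2 := by
  unfold grid; ring

theorem grid_self {n : ℕ} (hn : n ≠ 0) : grid n n = 3 / 4 := by
  unfold grid; field_simp

theorem exists_grid_cell (n : ℕ) {N : ℕ} (hN : 1 ≤ N) {y : ℝ} (hy0 : 0 ≤ y) (hy : y ≤ grid n N) :
    ∃ j < N, grid n j ≤ y ∧ y ≤ grid n (j + 1) := by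
  induction N, hN using Nat.le_induction with
  | base => exact ⟨0, by omega, by simpa [grid] using hy0, hy⟩
  | succ N _ ih =>
    rcases le_total y (grid n N) with h | h
    · obtain ⟨j, hj, h1⟩ := ih h
      exact ⟨j, by omega, h1⟩
    · exact ⟨N, by omega, h, hy⟩

/-- Steps of differences inside a cell of the grid are small enough for the Ditzian–Totik
modulus. -/
theorem step_le_phiDT {l m n k : ℕ} (hl : 1 ≤ l) (hm : 1 ≤ m) (hmn : 49 * m ≤ n ^ 2)
    (hk : k + 2 ≤ n) {a η : ℝ} (ha : grid n k ≤ a) (hη : 0 < η)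
    (hb : a + (2 * l : ℕ) * η ≤ grid n (k + 2)) : η ≤ phiDT (a + l * η) / Real.sqrt m := by
  have hmR : (0 : ℝ) < m := by exact_mod_cast hm
  have hnN : 0 < n := by omega
  have hnR : (0 : ℝ) < n := by exact_mod_cast hnN
  have hlR : (1 : ℝ) ≤ l := by exact_mod_cast hl
  have hmn' : 49 * (m : ℝ) ≤ n ^ 2 := by exact_mod_cast hmn
  have ha0 : 0 ≤ a := (grid_nonneg n k).trans ha
  have hlη : η ≤ l * η := le_mul_of_one_le_left hη.le hlR
  push_cast at hb
  set c := a + l * η with hc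
  have hc34 : c ≤ 3 / 4 := by
    have := grid_mono n hk
    rw [grid_self hnN.ne'] at this
    nlinarith
  rw [le_div_iff₀ (Real.sqrt_pos.2 hmR), phiDT]
  refine Real.le_sqrt_of_sq_le ?_
  rw [mul_pow, Real.sq_sqrt hmR.le]
  have hstep : 2 * η * n ^ 2 ≤ 3 * (k + 1) := by
    have h1 : 2 * η ≤ grid n (k + 2) - grid n k := by nlinarith
    have h2 : (grid n (k + 2) - grid n k) * n ^ 2 = 3 * (k + 1) := by
      unfold grid; push_cast; field_simp; ring
    rw [← h2]; gcongr
  have hmη : 98 * (η * m) ≤ 3 * (k + 1) := by nlinarith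
  have hc4 : c / 4 ≤ c * (1 - c) := by nlinarith
  refine le_trans ?_ hc4
  rcases Nat.eq_zero_or_pos k with rfl | hk0
  · simp only [Nat.cast_zero, zero_add] at hmη
    nlinarith
  · have hkR : (1 : ℝ) ≤ k := by exact_mod_cast hk0
    have h1 : 196 * (η ^ 2 * m * n ^ 2) ≤ 9 * (k + 1) ^ 2 := by
      have : (98 * (η * m)) * (2 * η * n ^ 2) ≤ (3 * (k + 1)) * (3 * (k + 1)) := by gcongr
      nlinarith
    have h2 : 9 * ((k : ℝ) + 1) ^ 2 ≤ 36 * k ^ 2 := by nlinarith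
    have h3 : 3 / 4 * (k : ℝ) ^ 2 ≤ c * n ^ 2 := by
      have h4 : grid n k ≤ c := by nlinarith
      have h5 : grid n k * n ^ 2 = 3 / 4 * (k : ℝ) ^ 2 := by unfold grid; field_simp
      rw [← h5]; gcongr
    have hn2 : (0 : ℝ) < (n : ℝ) ^ 2 := by positivity
    refine le_of_mul_le_mul_right ?_ hn2
    nlinarith

/-- Piecewise polynomial approximations of `f` on the overlapping cells
`[grid n k, grid n (k + 2)]`, where `n` is of the order of `√m`. -/
structure GridApprox (r m n : ℕ) (f : ℝ → ℝ) (ω : ℝ) (P : ℕ → Polynomial ℝ) : Prop where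
  one_le : 1 ≤ m
  le_n : 14 ≤ n
  le_sq : 49 * m ≤ n ^ 2
  sq_le : n ^ 2 ≤ 196 * m
  degree_lt : ∀ k, (P k).degree < r
  near : ∀ k, k + 2 ≤ n → ∀ y ∈ Icc (grid n k) (grid n (k + 2)), |f y - (P k).eval y| ≤ ω

theorem exists_gridApprox {l : ℕ} (hl : 1 ≤ l) : ∃ W : ℝ, 0 < W ∧
    ∀ (m : ℕ) (f : ℝ → ℝ) (M ω : ℝ), 1 ≤ m → (∀ y ∈ Icc (0 : ℝ) 1, |f y| ≤ M) →
      DTBound l m f ω → ∃ n P, GridApprox (2 * l) m n f (W * ω) P := by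
  obtain ⟨W, hW, h⟩ := exists_polynomial_near_Icc (2 * l) (by omega)
  refine ⟨W, hW, fun m f M ω hm hM hf => ?_⟩
  set s := Nat.sqrt m with hs
  have hs1 : 1 ≤ s := Nat.sqrt_pos.2 hm
  have hle : s ^ 2 ≤ m := Nat.sqrt_le' m
  have hlt : m < (s + 1) ^ 2 := Nat.lt_succ_sqrt' m
  set n := 7 * (s + 1) with hn
  have hmn : 49 * m ≤ n ^ 2 := by rw [hn]; nlinarith
  have hn0 : 0 < n := by omega
  have hcell : ∀ k, ∃ P : Polynomial ℝ, P.degree < (2 * l : ℕ) ∧ (k + 2 ≤ n →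
      ∀ y ∈ Icc (grid n k) (grid n (k + 2)), |f y - P.eval y| ≤ W * ω) := by
    intro k
    by_cases hk : k + 2 ≤ n
    · have htop : grid n (k + 2) ≤ 3 / 4 := by
        have := grid_mono n hk
        rwa [grid_self hn0.ne'] at this
      obtain ⟨P, hP, hPf⟩ := h f ω M (grid n k) (grid n (k + 2))
        (by
          have : (0 : ℝ) < n := by exact_mod_cast hn0
          unfold grid; push_cast; gcongr; linarith)
        (fun y hy => hM y ⟨(grid_nonneg n k).trans hy.1, by linarith [hy.2]⟩)
        (fun a η ha hη hb => hf a η ((grid_nonneg n k).trans ha) hη (by linarith)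
          (step_le_phiDT hl hm hmn hk ha hη hb))
      exact ⟨P, hP, fun _ => hPf⟩
    · exact ⟨0, Polynomial.degree_zero.trans_lt (WithBot.bot_lt_coe _), fun h => absurd h hk⟩
  choose P hP hPf using hcell
  exact ⟨n, P, hm, by omega, hmn, by rw [hn]; nlinarith, hP, hPf⟩

theorem abs_sub_le_mul_of_step {F : ℕ → ℝ} {B : ℝ} {i j : ℕ} (hij : i ≤ j)
    (h : ∀ k, i ≤ k → k < j → |F (k + 1) - F k| ≤ B) : |F j - F i| ≤ ((j : ℝ) - i) * B := by
  induction j, hij using Nat.le_induction with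
  | base => simp
  | succ j hij ih =>
    have h1 := ih fun k h1 h2 => h k h1 (by omega)
    have h2 := abs_sub_le (F (j + 1)) (F j) (F i)
    have h3 := h j hij (by omega)
    push_cast; linarith

namespace GridApprox

variable {r m n : ℕ} {f : ℝ → ℝ} {ω : ℝ} {P : ℕ → Polynomial ℝ}

theorem omega_nonneg (H : GridApprox r m n f ω P) : 0 ≤ ω :=
  (abs_nonneg _).trans (H.near 0 (by linarith [H.le_n]) _ ⟨le_rfl, grid_mono n (by omega)⟩)

theorem abs_step_le (H : GridApprox r m n f ω P) {k : ℕ} (hk : k + 3 ≤ n) {y : ℝ}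
    (hy : y ∈ Icc (grid n (k + 1)) (grid n (k + 2))) :
    |(P (k + 1) - P k).eval y| ≤ 2 * ω := by
  have h1 := H.near k (by omega) y ⟨(grid_mono n (by omega)).trans hy.1, hy.2⟩
  have h2 := H.near (k + 1) (by omega) y ⟨hy.1, hy.2.trans (grid_mono n (by omega))⟩
  rw [Polynomial.eval_sub]
  rw [abs_le] at *
  constructor <;> linarith [h1.1, h1.2, h2.1, h2.2]

theorem degree_step_lt (H : GridApprox r m n f ω P) (k : ℕ) : (P (k + 1) - P k).degree < r :=
  (Polynomial.degree_sub_le _ _).trans_lt (max_lt (H.degree_lt _) (H.degree_lt _))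

theorem cast_pos (H : GridApprox r m n f ω P) : (0 : ℝ) < m ∧ (0 : ℝ) < n ∧
    49 * (m : ℝ) ≤ n ^ 2 ∧ (n : ℝ) ^ 2 ≤ 196 * m := by
  have h1 := H.one_le
  have h2 := H.le_n
  exact ⟨by exact_mod_cast h1, by exact_mod_cast (by omega : 0 < n), by exact_mod_cast H.le_sq,
    by exact_mod_cast H.sq_le⟩

theorem grid_le (H : GridApprox r m n f ω P) (k : ℕ) : grid n k ≤ (k : ℝ) ^ 2 / m := by
  obtain ⟨hm, hn, h1, -⟩ := H.cast_pos
  unfold grid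
  rw [div_le_div_iff₀ (by positivity) hm]
  have : (0 : ℝ) ≤ (k : ℝ) ^ 2 := by positivity
  nlinarith

theorem le_grid_step (H : GridApprox r m n f ω P) (k : ℕ) :
    ((k : ℝ) + 1) / (196 * m) ≤ grid n (k + 2) - grid n (k + 1) := by
  obtain ⟨hm, hn, -, h2⟩ := H.cast_pos
  rw [grid_sub, div_le_div_iff₀ (by positivity) (by positivity)]
  push_cast
  have : ((k : ℝ) + 1) * n ^ 2 ≤ (k + 1) * (196 * m) := by gcongr
  nlinarith [mul_nonneg (Nat.cast_nonneg (α := ℝ) k) hm.le]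

theorem grid_step_le (H : GridApprox r m n f ω P) (k : ℕ) :
    grid n (k + 2) - grid n (k + 1) ≤ ((k : ℝ) + 1) ^ 2 / m := by
  obtain ⟨hm, hn, h1, -⟩ := H.cast_pos
  rw [grid_sub, div_le_div_iff₀ (by positivity) hm]
  push_cast
  have h3 : ((k : ℝ) + 1) ^ 2 * (49 * m) ≤ (k + 1) ^ 2 * n ^ 2 := by gcongr
  have hk : (0 : ℝ) ≤ k := by positivity
  nlinarith [mul_nonneg hk hm.le, mul_nonneg (mul_nonneg hk hk) hm.le]

end GridApprox

/-- The polynomials of two cells differ at `y` by a power of the distance of `y` to a point `x`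
of one of the cells, measured in the local scale. -/
theorem exists_abs_cell_sub_le {l : ℕ} (hl : 1 ≤ l) : ∃ C : ℝ, 0 < C ∧ ∀ (m n i j : ℕ)
    (f : ℝ → ℝ) (ω : ℝ) (P : ℕ → Polynomial ℝ) (x y : ℝ), GridApprox (2 * l) m n f ω P →
    i + 2 ≤ n → j + 2 ≤ n → grid n i ≤ x → x ≤ grid n (i + 1) →
    grid n j ≤ y → (j < i → y ≤ grid n (j + 1)) →
    |(P j).eval y - (P i).eval y| ≤ C * ω * (1 + ((y - x) / ((i + 1) / m)) ^ (2 * l)) := by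
  obtain ⟨G, hG, hgrow⟩ := exists_growth (2 * l)
  refine ⟨2 * G * 600 ^ (2 * l), by positivity, fun m n i j f ω P x y H hi hj hx0 hx1 hy hji => ?_⟩
  obtain ⟨hm, hn, -, hnm⟩ := H.cast_pos
  have hω := H.omega_nonneg
  set h : ℝ := ((i : ℝ) + 1) / m with hh
  have hhp : 0 < h := by positivity
  set u : ℝ := |(y - x) / h| with hu
  have hu0 : 0 ≤ u := abs_nonneg _
  have huh : |y - x| = u * h := by
    rw [hu, abs_div, abs_of_pos hhp]; field_simp
  have hgrid : ∀ a b : ℕ, (grid n b - grid n a) * n ^ 2 = 3 / 4 * (((b : ℝ) - a) * (b + a)) :=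
    fun a b => by rw [grid_sub]; field_simp
  have hstep : ∀ k, k + 3 ≤ n → ∀ T : ℝ, 1 ≤ T →
      |y - grid n (k + 1)| ≤ T * (grid n (k + 2) - grid n (k + 1)) →
      |(P (k + 1)).eval y - (P k).eval y| ≤ G * (2 * ω) * T ^ (2 * l - 1) := by
    intro k hk T hT hyT
    have hpos : 0 < grid n (k + 2) - grid n (k + 1) :=
      lt_of_lt_of_le (by positivity) (H.le_grid_step k)
    have := (hgrow (P (k + 1) - P k) (2 * ω) (grid n (k + 1)) _ (H.degree_step_lt k) hpos
      (fun z hz => H.abs_step_le hk (by rwa [add_sub_cancel] at hz))).1 T y hT hyT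
    rwa [Polynomial.eval_sub] at this
  have hun : u * h * n ^ 2 ≤ u * (i + 1) * 196 := by
    calc u * h * n ^ 2 ≤ u * h * (196 * m) := by gcongr
      _ = _ := by rw [hh]; field_simp
  have hi1 : (0 : ℝ) < (i : ℝ) + 1 := by positivity
  have hkey : |(P j).eval y - (P i).eval y|
      ≤ (1 + 300 * u) * (G * (2 * ω) * (1 + 300 * u) ^ (2 * l - 1)) := by
    rcases lt_trichotomy i j with hij | rfl | hij
    · have hyx : |y - x| = y - x := abs_of_nonneg (by
        linarith [grid_mono n (show i + 1 ≤ j by omega)])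
      have hcount : (j : ℝ) - i ≤ 1 + 300 * u := by
        have h1 : (grid n j - grid n (i + 1)) * n ^ 2 ≤ u * h * n ^ 2 := by
          rw [← huh, hyx]; gcongr
        rw [hgrid] at h1
        push_cast at h1
        have hij' : (i : ℝ) + 1 ≤ j := by exact_mod_cast hij
        have h2 : ((j : ℝ) - (i + 1)) * (2 * (i + 1)) ≤ (j - (i + 1)) * (j + (i + 1)) :=
          mul_le_mul_of_nonneg_left (by linarith) (by linarith)
        have h3 : ((j : ℝ) - (i + 1)) * (i + 1) ≤ 300 * u * (i + 1) := by nlinarith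
        have := le_of_mul_le_mul_right h3 hi1
        linarith
      refine (abs_sub_le_mul_of_step (F := fun k => (P k).eval y) hij.le
        (B := G * (2 * ω) * (1 + 300 * u) ^ (2 * l - 1)) fun k hik hkj => ?_).trans
        (mul_le_mul_of_nonneg_right hcount (by positivity))
      refine hstep k (by omega) _ (by linarith) ?_
      have hk1 := grid_mono n (show i + 1 ≤ k + 1 by omega)
      have hk2 := grid_mono n (show k + 1 ≤ j by omega)
      rw [abs_of_nonneg (by linarith)]
      have hik' : (i : ℝ) ≤ k := by exact_mod_cast hik
      calc y - grid n (k + 1) ≤ u * h := by rw [← huh, hyx]; linarith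
        _ = 196 * u * ((i + 1) / (196 * m)) := by rw [hh]; field_simp
        _ ≤ 196 * u * ((k + 1) / (196 * m)) := by gcongr
        _ ≤ 196 * u * (grid n (k + 2) - grid n (k + 1)) := by gcongr; exact H.le_grid_step k
        _ ≤ _ := by
          have : 0 ≤ grid n (k + 2) - grid n (k + 1) :=
            sub_nonneg.2 (grid_mono n (by omega))
          gcongr; linarith
    · simp only [sub_self, abs_zero]; positivity
    · have hyj := hji hij
      have hyx : |y - x| = x - y := by
        rw [abs_sub_comm]
        exact abs_of_nonneg (by linarith [grid_mono n (show j + 1 ≤ i by omega)])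
      have hij' : (j : ℝ) + 1 ≤ i := by exact_mod_cast hij
      have hj0 : (0 : ℝ) ≤ j := by positivity
      have hcount : (i : ℝ) - j ≤ 1 + 300 * u := by
        have h1 : (grid n i - grid n (j + 1)) * n ^ 2 ≤ u * h * n ^ 2 := by
          rw [← huh, hyx]; gcongr
        rw [hgrid] at h1
        push_cast at h1
        have h2 : ((i : ℝ) - (j + 1)) * (i + 1) ≤ (i - (j + 1)) * (i + (j + 1)) :=
          mul_le_mul_of_nonneg_left (by linarith) (by linarith)
        have h3 : ((i : ℝ) - (j + 1)) * (i + 1) ≤ 300 * u * (i + 1) := by nlinarith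
        have := le_of_mul_le_mul_right h3 hi1
        linarith
      rw [abs_sub_comm]
      refine (abs_sub_le_mul_of_step (F := fun k => (P k).eval y) hij.le
        (B := G * (2 * ω) * (1 + 300 * u) ^ (2 * l - 1)) fun k hik hkj => ?_).trans
        (mul_le_mul_of_nonneg_right hcount (by positivity))
      refine hstep k (by omega) _ (by linarith) ?_
      have hk1 := grid_mono n (show j + 1 ≤ k + 1 by omega)
      rw [abs_sub_comm, abs_of_nonneg (by linarith)]
      have hik' : (j : ℝ) ≤ k := by exact_mod_cast hik
      have hkj' : (k : ℝ) + 1 ≤ i := by exact_mod_cast hkj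
      have hn2 : (0 : ℝ) < (n : ℝ) ^ 2 := by positivity
      refine le_of_mul_le_mul_right ?_ hn2
      have h1 : (grid n (k + 1) - y) * n ^ 2 ≤ (grid n (k + 1) - grid n j) * n ^ 2 := by gcongr
      refine h1.trans ?_
      rw [mul_assoc, hgrid, hgrid]
      push_cast
      have h2 : ((k : ℝ) + 1 - j) * (k + 1 + j) ≤ (1 + 300 * u) * (2 * k + 3) := by
        apply mul_le_mul <;> linarith
      linarith
  refine hkey.trans ?_
  have hpow : (1 + 300 * u) ^ (2 * l) ≤ 600 ^ (2 * l) * (1 + ((y - x) / h) ^ (2 * l)) := by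
    refine (add_pow_even_le _ _ _).trans ?_
    rw [one_pow, mul_pow, hu, (even_two_mul l).pow_abs, show (600 : ℝ) = 2 * 300 by norm_num,
      mul_pow, mul_assoc]
    have h1 : (1 : ℝ) ≤ 300 ^ (2 * l) := one_le_pow₀ (by norm_num)
    gcongr
    linarith
  calc _ = 2 * G * ω * (1 + 300 * u) ^ (2 * l) := by
        rw [show (2 * l) = (2 * l - 1) + 1 by omega, pow_succ]; simp only [Nat.add_sub_cancel]; ring
    _ ≤ 2 * G * ω * (600 ^ (2 * l) * (1 + ((y - x) / h) ^ (2 * l))) := by gcongr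
    _ = _ := by ring

/-- The polynomial of a cell is close to `f` on `[0, 3/4]`, relative to a polynomial weight. -/
theorem exists_abs_sub_cell_le {l : ℕ} (hl : 1 ≤ l) : ∃ C : ℝ, 0 < C ∧ ∀ (m n i : ℕ)
    (f : ℝ → ℝ) (ω : ℝ) (P : ℕ → Polynomial ℝ) (x y : ℝ), GridApprox (2 * l) m n f ω P →
    i + 2 ≤ n → grid n i ≤ x → x ≤ grid n (i + 1) → 0 ≤ y → y ≤ 3 / 4 →
    |f y - (P i).eval y| ≤ C * ω * (1 + ((y - x) / ((i + 1) / m)) ^ (2 * l)) := by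
  obtain ⟨C, hC, h⟩ := exists_abs_cell_sub_le hl
  refine ⟨1 + C, by positivity, fun m n i f ω P x y H hi hx0 hx1 hy0 hy1 => ?_⟩
  have hn := H.le_n
  have hω := H.omega_nonneg
  obtain ⟨j, hj, hyj, hyj2, hji⟩ : ∃ j, j + 2 ≤ n ∧ grid n j ≤ y ∧ y ≤ grid n (j + 2) ∧
      (j < i → y ≤ grid n (j + 1)) := by
    obtain ⟨j, hj, h1, h2⟩ := exists_grid_cell n (show 1 ≤ n by omega) hy0
      (by rwa [grid_self (by omega)])
    by_cases hjn : j + 2 ≤ n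
    · exact ⟨j, hjn, h1, h2.trans (grid_mono n (by omega)), fun _ => h2⟩
    · refine ⟨n - 2, by omega, (grid_mono n (by omega)).trans h1, ?_, fun h => by omega⟩
      rwa [show n - 2 + 2 = j + 1 by omega]
  have h1 := H.near j hj y ⟨hyj, hyj2⟩
  have h2 := h m n i j f ω P x y H hi hj hx0 hx1 hyj hji
  have h3 := abs_sub_le (f y) ((P j).eval y) ((P i).eval y)
  have h4 := (even_two_mul l).pow_nonneg ((y - x) / (((i : ℝ) + 1) / m))
  nlinarith [mul_nonneg hω h4]

/-- Coefficients of the polynomial of the last cell. -/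
theorem exists_wnorm_last_le {l : ℕ} (hl : 1 ≤ l) : ∃ C : ℝ, 0 < C ∧ ∀ (m n : ℕ)
    (f : ℝ → ℝ) (M ω : ℝ) (P : ℕ → Polynomial ℝ), GridApprox (2 * l) m n f ω P →
    (∀ y ∈ Icc (0 : ℝ) 1, |f y| ≤ M) →
    wnorm (2 * l) 1 (P (n - 2)) ≤ C * (m ^ l * (ω + M / m ^ l)) := by
  obtain ⟨K, hK, hKf⟩ := exists_abs_sub_cell_le hl
  obtain ⟨G, hG, hgrow⟩ := exists_growth (2 * l)
  set E : ℝ := (1 / (3 / 4)) ^ (2 * l - 1) with hE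
  have hEp : 0 < E := by positivity
  refine ⟨G * (1 + 2 * K) * E, by positivity, fun m n f M ω P H hM => ?_⟩
  obtain ⟨hm, hn, hmn, -⟩ := H.cast_pos
  have hω := H.omega_nonneg
  have hM0 : 0 ≤ M := (abs_nonneg _).trans (hM 0 (by simp))
  have hn14 := H.le_n
  have hn14' : (14 : ℝ) ≤ n := by exact_mod_cast hn14
  have hm1 : (1 : ℝ) ≤ m ^ l := one_le_pow₀ (by exact_mod_cast H.one_le)
  have hq : ((n - 2 : ℕ) : ℝ) = n - 2 := by rw [Nat.cast_sub (by omega)]; norm_num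
  have hbd : ∀ y ∈ Icc (0 : ℝ) (0 + 3 / 4), |(P (n - 2)).eval y| ≤ M + 2 * K * ω * m ^ l := by
    intro y hy
    rw [zero_add] at hy
    set x := grid n (n - 2) with hx
    have hx0 : 0 ≤ x := grid_nonneg _ _
    have hx1 : x ≤ 3 / 4 := by
      rw [← grid_self (show n ≠ 0 by omega)]; exact grid_mono n (by omega)
    have h1 := hKf m n (n - 2) f ω P x y H (by omega) le_rfl (grid_mono n (by omega)) hy.1 hy.2
    have h2 : ((y - x) / ((((n - 2 : ℕ) : ℝ) + 1) / m)) ^ (2 * l) ≤ m ^ l := by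
      rw [pow_mul]
      refine pow_le_pow_left₀ (sq_nonneg _) ?_ l
      rw [hq, div_div_eq_mul_div, div_pow, div_le_iff₀ (by nlinarith)]
      have h3 : (y - x) ^ 2 ≤ 1 := by
        rw [sq_le_one_iff_abs_le_one, abs_le]; constructor <;> linarith [hy.1, hy.2]
      have h4 : (m : ℝ) ≤ (n - 2 + 1) ^ 2 := by nlinarith
      calc ((y - x) * (m : ℝ)) ^ 2 = (y - x) ^ 2 * ((m : ℝ) * m) := by ring
        _ ≤ 1 * ((m : ℝ) * m) := by gcongr
        _ ≤ (m : ℝ) * ((n : ℝ) - 2 + 1) ^ 2 := by rw [one_mul]; gcongr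
    have h3 := hM y ⟨hy.1, by linarith [hy.2]⟩
    have h4 : K * ω * (1 + ((y - x) / ((((n - 2 : ℕ) : ℝ) + 1) / m)) ^ (2 * l))
        ≤ K * ω * (m ^ l + m ^ l) := by gcongr
    have h5 := abs_sub_abs_le_abs_sub ((P (n - 2)).eval y) (f y)
    rw [abs_sub_comm] at h5
    linarith
  have h1 := (hgrow (P (n - 2)) _ 0 (3 / 4) (H.degree_lt _) (by norm_num) hbd).2 1 le_rfl
    (by norm_num) (by norm_num)
  refine h1.trans ?_
  rw [← hE]
  have e : (m : ℝ) ^ l * (ω + M / m ^ l) = m ^ l * ω + M := by field_simp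
  rw [e]
  have : M + 2 * K * ω * m ^ l ≤ (1 + 2 * K) * (m ^ l * ω + M) := by
    have : 0 ≤ m ^ l * ω := by positivity
    nlinarith [mul_nonneg hK.le hM0]
  calc _ ≤ G * ((1 + 2 * K) * (m ^ l * ω + M)) * E := by gcongr
    _ = _ := by ring

/-- The polynomial of a cell of `[0, 1/2]` is close to `f` on `[0,1]`, relative to a polynomial
weight. -/
theorem exists_abs_sub_cell_le_of_le_half {l : ℕ} (hl : 1 ≤ l) : ∃ C : ℝ, 0 < C ∧ ∀ (m n i : ℕ)
    (f : ℝ → ℝ) (M ω : ℝ) (P : ℕ → Polynomial ℝ) (x : ℝ), GridApprox (2 * l) m n f ω P →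
    (∀ y ∈ Icc (0 : ℝ) 1, |f y| ≤ M) →
    i + 2 ≤ n → grid n i ≤ x → x ≤ grid n (i + 1) → x ≤ 1 / 2 → ∀ y ∈ Icc (0 : ℝ) 1,
    |f y - (P i).eval y| ≤ C * (ω + M / m ^ l) * (1 + ((y - x) / ((i + 1) / m)) ^ (2 * l)) := by
  obtain ⟨K, hK, hKf⟩ := exists_abs_sub_cell_le hl
  obtain ⟨D, hD, hDf⟩ := exists_abs_cell_sub_le hl
  obtain ⟨L, hL, hLf⟩ := exists_wnorm_last_le hl
  refine ⟨K + D + (1 + L) * 56 ^ (2 * l), by positivity,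
    fun m n i f M ω P x H hM hi hx0 hx1 hx y hy => ?_⟩
  obtain ⟨hm, hn, -, hmn⟩ := H.cast_pos
  have hn14 := H.le_n
  have hω := H.omega_nonneg
  have hM0 : 0 ≤ M := (abs_nonneg _).trans (hM 0 (by simp))
  set Ω := ω + M / (m : ℝ) ^ l with hΩ
  have hωΩ : ω ≤ Ω := by rw [hΩ]; linarith [show 0 ≤ M / (m : ℝ) ^ l by positivity]
  have hΩ0 : 0 ≤ Ω := hω.trans hωΩ
  set u := ((y - x) / (((i : ℝ) + 1) / m)) ^ (2 * l) with hu
  have hu0 : 0 ≤ u := (even_two_mul l).pow_nonneg _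
  rcases le_total y (3 / 4) with hy1 | hy1
  · refine (hKf m n i f ω P x y H hi hx0 hx1 hy.1 hy1).trans ?_
    rw [← hu]
    gcongr
    have : 0 ≤ D + (1 + L) * 56 ^ (2 * l) := by positivity
    linarith
  · have h1 := hDf m n i (n - 2) f ω P x y H hi (by omega) hx0 hx1 (by
      refine le_trans ?_ hy1
      rw [← grid_self (show n ≠ 0 by omega)]; exact grid_mono n (by omega)) (fun h => by omega)
    rw [← hu] at h1
    have h2 := abs_eval_le_wnorm (H.degree_lt (n - 2)) (S := 1) (y := y)
      (abs_le.2 ⟨by linarith [hy.1], hy.2⟩)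
    have h3 := hLf m n f M ω P H hM
    rw [← hΩ] at h3
    have h4 := hM y hy
    have h5 : (m : ℝ) ^ l ≤ 56 ^ (2 * l) * u := by
      rw [hu, ← mul_pow, pow_mul]
      refine pow_le_pow_left₀ hm.le ?_ l
      have hin : (i : ℝ) + 1 ≤ n := by exact_mod_cast (show i + 1 ≤ n by omega)
      rw [div_div_eq_mul_div, ← mul_div_assoc, div_pow, le_div_iff₀ (by positivity)]
      have h6 : ((i : ℝ) + 1) ^ 2 ≤ 196 * m := le_trans (by gcongr) hmn
      have h7 : (1 / 4 : ℝ) ^ 2 ≤ (y - x) ^ 2 := by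
        apply pow_le_pow_left₀ <;> linarith
      calc (m : ℝ) * (i + 1) ^ 2 ≤ m * (196 * m) := by gcongr
        _ = (56 ^ 2 * m ^ 2) * (1 / 4) ^ 2 := by ring
        _ ≤ (56 ^ 2 * m ^ 2) * (y - x) ^ 2 := by gcongr
        _ = _ := by ring
    have h8 : M ≤ m ^ l * Ω := by
      have : (m : ℝ) ^ l * Ω = m ^ l * ω + M := by rw [hΩ]; field_simp
      rw [this]
      have : 0 ≤ (m : ℝ) ^ l * ω := by positivity
      linarith
    have h9 : m ^ l * Ω ≤ 56 ^ (2 * l) * u * Ω := by gcongr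
    have h10 : |f y - (P i).eval y| ≤ |f y| + |(P (n - 2)).eval y|
        + |(P (n - 2)).eval y - (P i).eval y| := by
      have := abs_sub_le (f y) ((P (n - 2)).eval y) ((P i).eval y)
      have := abs_sub (f y) ((P (n - 2)).eval y)
      linarith
    have h11 : D * ω * (1 + u) ≤ D * Ω * (1 + u) := by gcongr
    have h12 : (1 + L) * (m ^ l * Ω) ≤ (1 + L) * (56 ^ (2 * l) * u * Ω) := by gcongr
    have h13 : 0 ≤ (1 + L) * 56 ^ (2 * l) * Ω + K * Ω * (1 + u) := by positivity
    calc _ ≤ (1 + L) * (m ^ l * Ω) + D * ω * (1 + u) := by linarith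
      _ ≤ (1 + L) * (56 ^ (2 * l) * u * Ω) + D * Ω * (1 + u)
          + ((1 + L) * 56 ^ (2 * l) * Ω + K * Ω * (1 + u)) := by linarith
      _ = _ := by ring

/-- `(I - B_m)^l` applied to the polynomial of a cell, at a point of this cell. -/
theorem exists_abs_iterate_cell_le {l : ℕ} (hl : 1 ≤ l) : ∃ C : ℝ, 0 < C ∧ ∀ (m n i : ℕ)
    (f : ℝ → ℝ) (M ω : ℝ) (P : ℕ → Polynomial ℝ) (x : ℝ), GridApprox (2 * l) m n f ω P →
    (∀ y ∈ Icc (0 : ℝ) 1, |f y| ≤ M) → i + 2 ≤ n → 0 ≤ x → x ≤ grid n (i + 1) → x ≤ 1 →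
    |((fun g => g - Bop m g)^[l] (fun y => (P i).eval y)) x| ≤ C * (ω + M / m ^ l) := by
  obtain ⟨L, hL, hLf⟩ := exists_wnorm_last_le hl
  obtain ⟨B, hB, hBf⟩ := exists_abs_iterate_eval_le (2 * l) hl (A := 196) (by norm_num)
  obtain ⟨G, hG, hgrow⟩ := exists_growth (2 * l)
  set K : ℝ := B * (G * 2 * 196 ^ (2 * l - 1)) with hK
  have hKp : 0 < K := by positivity
  refine ⟨B * L + 2 * K, by positivity, fun m n i f M ω P x H hM hi hx0 hx1 hx => ?_⟩
  obtain ⟨hm, hn, -, hnm⟩ := H.cast_pos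
  have hm1 := H.one_le
  have hm1' : (1 : ℝ) ≤ m := by exact_mod_cast hm1
  have hn14 := H.le_n
  have hω := H.omega_nonneg
  have hM0 : 0 ≤ M := (abs_nonneg _).trans (hM 0 (by simp))
  set A : ℕ → ℝ := fun k => ((fun g => g - Bop m g)^[l] (fun y => (P k).eval y)) x with hA
  have hlast : |A (n - 2)| ≤ B * L * (ω + M / m ^ l) := by
    have h1 := hBf m 1 x (P (n - 2)) hm1 (by simpa using hm1') (by norm_num) (H.degree_lt _) hx0 hx
    have h2 := hLf m n f M ω P H hM
    have hw := wnorm_nonneg (2 * l) zero_le_one (P (n - 2))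
    refine h1.trans ?_
    rw [div_one, mul_one]
    calc _ ≤ 1 * (B / m ^ l * wnorm (2 * l) 1 (P (n - 2))) := by gcongr
      _ ≤ 1 * (B / m ^ l * (L * (m ^ l * (ω + M / m ^ l)))) := by gcongr
      _ = _ := by field_simp
  have hstep : ∀ k, i ≤ k → k + 3 ≤ n →
      |A (k + 1) - A k| ≤ K * ω * ((i + 1) ^ 2 / (k + 1) ^ 3) := by
    intro k hik hk
    set D := P (k + 1) - P k with hD
    have hAD : A (k + 1) - A k = ((fun g => g - Bop m g)^[l] (fun y => D.eval y)) x := by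
      have e : (fun y => (P (k + 1)).eval y) = (fun y => (P k).eval y) + fun y => D.eval y := by
        funext y; simp [hD]
      simp only [hA]
      rw [e, iterate_sub_Bop_add, Pi.add_apply, add_sub_cancel_left]
    have hik' : (i : ℝ) ≤ k := by exact_mod_cast hik
    have hkn : (k : ℝ) + 1 ≤ n := by exact_mod_cast (show k + 1 ≤ n by omega)
    set S : ℝ := ((k : ℝ) + 1) ^ 2 / m with hS
    have hmS : m * S = (k + 1) ^ 2 := by rw [hS]; field_simp
    have hSp : 0 < S := by positivity
    have hxi : x ≤ (i + 1) ^ 2 / m := by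
      have := hx1.trans (H.grid_le (i + 1))
      push_cast at this; exact this
    have hxS : x ≤ S := hxi.trans (by rw [hS]; gcongr)
    have hη := H.le_grid_step k
    have hηp : 0 < grid n (k + 2) - grid n (k + 1) := lt_of_lt_of_le (by positivity) hη
    have h1 := hBf m S x D hm1
      (by rw [hmS]; exact one_le_pow₀ (by linarith [show (0 : ℝ) ≤ k by positivity]))
      (by rw [hS, div_le_iff₀ hm]; exact le_trans (by gcongr) hnm) (H.degree_step_lt k) hx0 hxS
    have h2 := (hgrow D (2 * ω) (grid n (k + 1)) _ (H.degree_step_lt k) hηp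
      (fun z hz => H.abs_step_le hk (by rwa [add_sub_cancel] at hz))).2 S (grid_nonneg _ _)
      (by have := H.grid_le (k + 1); push_cast at this; exact this) (H.grid_step_le k)
    have h3 : S / (grid n (k + 2) - grid n (k + 1)) ≤ 196 * (k + 1) := by
      rw [div_le_iff₀ hηp]
      calc S = 196 * (k + 1) * (((k : ℝ) + 1) / (196 * m)) := by rw [hS]; field_simp
        _ ≤ _ := by gcongr
    have h4 : wnorm (2 * l) S D ≤ G * (2 * ω) * (196 * (k + 1)) ^ (2 * l - 1) :=
      h2.trans (by gcongr)
    have h5 : x / S ≤ (i + 1) ^ 2 / (k + 1) ^ 2 := by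
      rw [div_le_div_iff₀ hSp (by positivity), ← hmS]
      rw [le_div_iff₀ hm] at hxi
      calc x * (m * S) = x * m * S := by ring
        _ ≤ _ := by gcongr
    rw [hAD]
    refine h1.trans ?_
    rw [hmS, ← pow_mul]
    have hwn := wnorm_nonneg (2 * l) hSp.le D
    calc _ ≤ (i + 1) ^ 2 / (k + 1) ^ 2 * (B / ((k : ℝ) + 1) ^ (2 * l)
          * (G * (2 * ω) * (196 * (k + 1)) ^ (2 * l - 1))) := by gcongr
      _ = _ := by
        have e : ((k : ℝ) + 1) ^ (2 * l) = (k + 1) ^ (2 * l - 1) * (k + 1) := by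
          rw [← pow_succ]; congr 1; omega
        rw [e, hK, mul_pow]; field_simp
  have hsum : ∀ j, i ≤ j → j + 2 ≤ n →
      |A j - A i| ≤ 2 * K * ω * (i + 1) ^ 2 * (1 / (i + 1) ^ 2 - 1 / (j + 1) ^ 2) := by
    intro j hij
    induction j, hij using Nat.le_induction with
    | base => intro _; simp
    | succ j hij ih =>
      intro hj
      have h1 := ih (by omega)
      have h2 := hstep j hij (by omega)
      have h3 := abs_sub_le (A (j + 1)) (A j) (A i)
      have h4 : (1 : ℝ) / (j + 1) ^ 3 ≤ 2 * (1 / (j + 1) ^ 2 - 1 / (j + 1 + 1) ^ 2) := by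
        have hj0 : (0 : ℝ) ≤ j := by positivity
        rw [div_sub_div _ _ (by positivity) (by positivity), ← mul_div_assoc,
          div_le_div_iff₀ (by positivity) (by positivity)]
        have : 0 ≤ ((j : ℝ) + 1) ^ 2 * (3 * (j + 1) ^ 2 - 1) :=
          mul_nonneg (by positivity) (by nlinarith)
        nlinarith
      have h5 : K * ω * ((i + 1) ^ 2 / (j + 1) ^ 3)
          ≤ K * ω * (i + 1) ^ 2 * (2 * (1 / ((j : ℝ) + 1) ^ 2 - 1 / (j + 1 + 1) ^ 2)) := by
        calc _ = K * ω * ((i : ℝ) + 1) ^ 2 * (1 / ((j : ℝ) + 1) ^ 3) := by ring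
          _ ≤ _ := by gcongr
      push_cast
      linarith
  have h1 := hsum (n - 2) (by omega) (by omega)
  have h2 : 2 * K * ω * (i + 1) ^ 2 * (1 / (i + 1) ^ 2 - 1 / (((n - 2 : ℕ) : ℝ) + 1) ^ 2)
      ≤ 2 * K * ω := by
    calc _ ≤ 2 * K * ω * ((i : ℝ) + 1) ^ 2 * (1 / (i + 1) ^ 2) := by
          gcongr
          linarith [show (0 : ℝ) ≤ 1 / (((n - 2 : ℕ) : ℝ) + 1) ^ 2 by positivity]
      _ = _ := by field_simp
  have h3 : |A i| ≤ |A (n - 2)| + |A (n - 2) - A i| := by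
    have := abs_sub (A (n - 2)) (A (n - 2) - A i)
    rwa [sub_sub_cancel] at this
  have h4 : 0 ≤ 2 * K * (M / m ^ l) := by positivity
  change |A i| ≤ _
  linarith

/-- The error estimate on `[0, 1/2]`. -/
theorem exists_abs_iterate_le_of_le_half {l : ℕ} (hl : 1 ≤ l) : ∃ C : ℝ, 0 < C ∧
    ∀ (m : ℕ) (f : ℝ → ℝ) (M ω x : ℝ), 1 ≤ m → (∀ y ∈ Icc (0 : ℝ) 1, |f y| ≤ M) →
      0 ≤ ω → DTBound l m f ω → 0 ≤ x → x ≤ 1 / 2 →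
      |((fun g => g - Bop m g)^[l] f) x| ≤ C * (ω + M / m ^ l) := by
  obtain ⟨W, hW, hWf⟩ := exists_gridApprox hl
  obtain ⟨K, hK, hKf⟩ := exists_abs_sub_cell_le_of_le_half hl
  obtain ⟨D, hD, hDf⟩ := exists_abs_iterate_cell_le hl
  obtain ⟨V, hV, hVf⟩ := exists_Bop_weight_le l
  set E : ℝ := K * (1 + V) ^ l + D with hE
  have hEp : 0 < E := by positivity
  refine ⟨E * (W + 1), by positivity, fun m f M ω x hm hM hω hf hx0 hx => ?_⟩
  obtain ⟨n, P, H⟩ := hWf m f M ω hm hM hf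
  have hM0 : 0 ≤ M := (abs_nonneg _).trans (hM 0 (by simp))
  have hn14 := H.le_n
  have hn14' : (14 : ℝ) ≤ n := by exact_mod_cast hn14
  obtain ⟨hmR, hnR, -, -⟩ := H.cast_pos
  obtain ⟨i, hi, hxi, hxi1⟩ := exists_grid_cell n (show 1 ≤ n - 1 by omega) hx0 (by
    refine hx.trans ?_
    rw [grid, Nat.cast_sub (by omega), le_div_iff₀ (by positivity)]
    push_cast
    nlinarith)
  have hi2 : i + 2 ≤ n := by omega
  set h : ℝ := ((i : ℝ) + 1) / m with hh
  set Ω := W * ω + M / (m : ℝ) ^ l with hΩ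
  have hΩ0 : 0 ≤ Ω := by positivity
  have hnear := hKf m n i f M (W * ω) P x H hM hi2 hxi hxi1 hx
  have hw := hVf m x h hm (by rw [hh]; gcongr; linarith [show (0 : ℝ) ≤ i by positivity]) (by
    refine (hxi1.trans (H.grid_le (i + 1))).trans (le_of_eq ?_)
    rw [hh]; push_cast; field_simp)
  have h1 := abs_iterate_sub_Bop_le (m := m) (c := K * Ω) (C := V)
    (w := fun z => 1 + ((z - x) / h) ^ (2 * l)) (g := fun y => f y - (P i).eval y)
    (by positivity) hV.le hw hnear l x ⟨hx0, by linarith⟩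
  have h2 := hDf m n i f M (W * ω) P x H hM hi2 hx0 hxi1 (by linarith)
  have e : f = (fun y => f y - (P i).eval y) + fun y => (P i).eval y := by
    funext y; simp
  have hw1 : 1 + ((x - x) / h) ^ (2 * l) = 1 := by
    rw [sub_self, zero_div, zero_pow (by omega), add_zero]
  simp only [hw1, mul_one] at h1
  have hsum : |((fun g => g - Bop m g)^[l] f) x| ≤ E * Ω := by
    rw [e, iterate_sub_Bop_add, Pi.add_apply]
    refine (abs_add_le _ _).trans ((add_le_add h1 h2).trans (le_of_eq ?_))
    rw [hE]; ring
  refine hsum.trans ?_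
  rw [mul_assoc]
  gcongr
  have : 0 ≤ W * (M / (m : ℝ) ^ l) := by positivity
  rw [hΩ]; linarith

theorem bern_reflect {m k : ℕ} (hk : k ≤ m) (x : ℝ) : bern m (m - k) (1 - x) = bern m k x := by
  rw [bern, bern, Nat.choose_symm hk, Nat.sub_sub_self hk, sub_sub_cancel]; ring

theorem Bop_reflect {m : ℕ} (hm : 1 ≤ m) (f : ℝ → ℝ) (x : ℝ) :
    Bop m (fun y => f (1 - y)) x = Bop m f (1 - x) := by
  have hmR : (m : ℝ) ≠ 0 := by exact_mod_cast (by omega : m ≠ 0)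
  simp only [Bop]
  rw [← Finset.sum_range_reflect (fun k => bern m k (1 - x) * f ((k : ℝ) / m))]
  refine Finset.sum_congr rfl fun k hk => ?_
  have hk' : k ≤ m := Nat.lt_succ_iff.1 (Finset.mem_range.1 hk)
  rw [show m + 1 - 1 - k = m - k by omega, bern_reflect hk', Nat.cast_sub hk', sub_div,
    div_self hmR]

theorem iterate_sub_Bop_reflect {m : ℕ} (hm : 1 ≤ m) (f : ℝ → ℝ) (l : ℕ) :
    (fun g => g - Bop m g)^[l] (fun y => f (1 - y))
      = fun x => ((fun g => g - Bop m g)^[l] f) (1 - x) := by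
  induction l with
  | zero => rfl
  | succ l ih =>
    rw [Function.iterate_succ_apply', Function.iterate_succ_apply', ih]
    funext x
    simp only [Pi.sub_apply, Bop_reflect hm]

theorem DTBound.reflect {l m : ℕ} {f : ℝ → ℝ} {ω : ℝ} (h : DTBound l m f ω) :
    DTBound l m (fun y => f (1 - y)) ω := fun a η ha hη h1 h2 => by
  rw [stepDiff_reflect]
  refine h _ _ (by linarith) hη (by linarith) ?_
  have e : phiDT (1 - (a + (2 * l : ℕ) * η) + l * η) = phiDT (a + l * η) := by
    unfold phiDT; congr 1; push_cast; ring
  rwa [e]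

/-- The error estimate in terms of an arbitrary bound of the differences. -/
theorem exists_abs_iterate_le {l : ℕ} (hl : 1 ≤ l) : ∃ C : ℝ, 0 < C ∧
    ∀ (m : ℕ) (f : ℝ → ℝ) (M ω : ℝ), 1 ≤ m → (∀ y ∈ Icc (0 : ℝ) 1, |f y| ≤ M) →
      0 ≤ ω → DTBound l m f ω → ∀ x ∈ Icc (0 : ℝ) 1,
      |((fun g => g - Bop m g)^[l] f) x| ≤ C * (ω + M / m ^ l) := by
  obtain ⟨C, hC, h⟩ := exists_abs_iterate_le_of_le_half hl
  refine ⟨C, hC, fun m f M ω hm hM hω hf x hx => ?_⟩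
  rcases le_total x (1 / 2) with hx2 | hx2
  · exact h m f M ω x hm hM hω hf hx.1 hx2
  · have := h m (fun y => f (1 - y)) M ω (1 - x) hm
      (fun y hy => hM _ ⟨by linarith [hy.2], by linarith [hy.1]⟩) hω hf.reflect
      (by linarith [hx.2]) (by linarith)
    rw [iterate_sub_Bop_reflect hm] at this
    simpa only [sub_sub_cancel] using this

theorem abs_le_supNorm {f : ℝ → ℝ} (hf : ContinuousOn f (Icc 0 1)) :
    ∀ y ∈ Icc (0 : ℝ) 1, |f y| ≤ supNorm f := by
  intro y hy
  obtain ⟨B, hB⟩ := isCompact_Icc.exists_bound_of_continuousOn hf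
  have hbdd : BddAbove (Set.range fun x : Icc (0 : ℝ) 1 => |f x|) :=
    ⟨B, by rintro _ ⟨z, rfl⟩; exact hB z z.2⟩
  exact le_ciSup hbdd ⟨y, hy⟩

theorem supNorm_le {f : ℝ → ℝ} {B : ℝ} (h : ∀ y ∈ Icc (0 : ℝ) 1, |f y| ≤ B) : supNorm f ≤ B :=
  haveI : Nonempty (Icc (0 : ℝ) 1) := ⟨⟨0, by simp⟩⟩
  ciSup_le fun x => h x x.2

theorem abs_dtDiff_le {r : ℕ} {h x M : ℝ} {f : ℝ → ℝ} (hM : ∀ y ∈ Icc (0 : ℝ) 1, |f y| ≤ M)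
    (hx : dtAdmissible r h x) :
    |dtDiff r h f x| ≤ ∑ k ∈ Finset.range (r + 1), (r.choose k : ℝ) * M := by
  refine (Finset.abs_sum_le_sum_abs _ _).trans (Finset.sum_le_sum fun k hk => ?_)
  rw [abs_mul, abs_mul, abs_pow, abs_neg, abs_one, one_pow, one_mul, Nat.abs_cast]
  exact mul_le_mul_of_nonneg_left
    (hM _ (hx.2 k (Nat.lt_succ_iff.1 (Finset.mem_range.1 hk)))) (by positivity)

/-- The modulus of smoothness bounds all differences of admissible step. -/
theorem DTBound_omegaDT {l m : ℕ} (hl : 1 ≤ l) (hm : 1 ≤ m) {f : ℝ → ℝ} {M : ℝ}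
    (hM : ∀ y ∈ Icc (0 : ℝ) 1, |f y| ≤ M) :
    DTBound l m f (omegaDT (2 * l) f (1 / Real.sqrt m)) := by
  intro a η ha hη h1 h2
  have hsm : 0 < Real.sqrt m := Real.sqrt_pos.2 (by exact_mod_cast hm)
  set c := a + l * η with hc
  have hφ : 0 < phiDT c := by
    rw [le_div_iff₀ hsm] at h2
    exact lt_of_lt_of_le (by positivity) h2
  have hnode : ∀ k : ℕ, c + (((2 * l : ℕ) : ℝ) - 2 * k) * (η / phiDT c / 2) * phiDT c
      = a + (((2 * l : ℕ) : ℝ) - k) * η := fun k => by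
    rw [hc] at hφ ⊢; push_cast; field_simp; ring
  refine le_csSup ⟨∑ k ∈ Finset.range (2 * l + 1), ((2 * l).choose k : ℝ) * M, ?_⟩
    ⟨η / phiDT c, c, by positivity, ?_, ⟨?_, fun k hk => ?_⟩, ?_⟩
  · rintro _ ⟨h, x, -, -, hx, rfl⟩
    exact abs_dtDiff_le hM hx
  · rw [div_le_div_iff₀ hφ hsm, one_mul]
    rwa [le_div_iff₀ hsm] at h2
  · have : (0 : ℝ) ≤ l * η := by positivity
    push_cast at h1
    exact ⟨by positivity, by rw [hc]; linarith⟩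
  · rw [hnode]
    have hk' : (k : ℝ) ≤ (2 * l : ℕ) := by exact_mod_cast hk
    exact ⟨by nlinarith, by nlinarith [show (0 : ℝ) ≤ k * η by positivity]⟩
  · congr 1
    rw [stepDiff, dtDiff, ← Finset.sum_range_reflect]
    refine Finset.sum_congr rfl fun k hk => ?_
    have hk' : k ≤ 2 * l := Nat.lt_succ_iff.1 (Finset.mem_range.1 hk)
    rw [hnode, show 2 * l + 1 - 1 - k = 2 * l - k by omega, Nat.choose_symm hk',
      Nat.cast_sub hk']
    congr 2
    have e : (-1 : ℝ) ^ (2 * l - k) * (-1) ^ k = 1 := by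
      rw [← pow_add, Nat.sub_add_cancel hk', pow_mul]; simp
    have e2 : (-1 : ℝ) ^ k * (-1) ^ k = 1 := by rw [← mul_pow]; simp
    calc (-1 : ℝ) ^ (2 * l - k) = (-1) ^ (2 * l - k) * ((-1) ^ k * (-1) ^ k) := by rw [e2, mul_one]
      _ = _ := by rw [← mul_assoc, e, one_mul]

theorem omegaDT_nonneg (r : ℕ) (f : ℝ → ℝ) (t : ℝ) : 0 ≤ omegaDT r f t :=
  Real.sSup_nonneg (by rintro _ ⟨h, x, -, -, -, rfl⟩; exact abs_nonneg _)

/-- Gonska–Zhou error estimate for generalized Bernstein polynomials. -/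
theorem genBernstein_error (l : ℕ) (hl : 1 ≤ l) :
    ∃ C > 0, ∀ m : ℕ, 1 ≤ m → ∀ f : ℝ → ℝ, ContinuousOn f (Set.Icc 0 1) →
      supNorm (fun x => f x - GBop m l f x) ≤
        C * (omegaDT (2 * l) f (1 / Real.sqrt m) + supNorm f / (m : ℝ) ^ l) := by
  obtain ⟨C, hC, h⟩ := exists_abs_iterate_le hl
  refine ⟨C, hC, fun m hm f hf => supNorm_le fun x hx => ?_⟩
  have hM := abs_le_supNorm hf
  simp only [GBop, sub_sub_cancel]
  exact h m f _ _ hm hM (omegaDT_nonneg _ _ _) (DTBound_omegaDT hl hm hM) x hx
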